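/- arXiv:1805.08424 — 3 statements merged into one kernel-verified Lean document; each statement's English description precedes it below -/
import Mathlib

section
/- For all d ∈ (0,1], δ > 0 and C ≥ 1 there exists ζ₀ > 0; for every 0 < ζ ≤ ζ₀ there exists η₀ > 0; for every 0 < η ≤ η₀ there exists n₀ ∈ ℕ such that the following holds for all n ≥ n₀. Let G' be an (η,d)-quasirandom n-vertex graph and let φ be an m-colouring of G' that is Cn-bounded and locally ηn-bounded. Then there exists a (ζ,d)-quasirandom spanning subgraph G of G' such that every edge uv of G satisfies d_G(u,v) = (d²±ζ)n and c^φ_G(u,v) ≤ ζn. Moreover, for every r ∈ ℕ and all nonnegative reals p₁,…,p_r with p_i ≥ n^{−1/2} for each i and Σ_{i∈[r]} p_i ≤ 1, if each vertex of G is independently assigned to the part V_i with probability p_i (and to no part with the remaining probability), then with probability at least 0.9 all of the following hold simultaneously: (A1) |V_i| = (1±ζ)p_i·n for each i ∈ [r]; (A2) G[V_i,V_j] is (ζ,d)-superregular for all i ≠ j ∈ [r]; (A3) for every edge vw of G and every i ∈ [r], |C^φ_G(v,w)∩V_i| ≤ ζ|V_i| and |N_G(v)∩N_G(w)∩V_i|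 = (d²±ζ)|V_i|; (A4) for each i ∈ [r], the induced subgraph G[V_i] is (ζ,d)-quasirandom (as a graph on |V_i| vertices). -/
namespace Paper

variable {V : Type*} {W : Type*} {C : Type*}

/-- The set of edges of `G` receiving colour `c` under `φ`. -/
def colourCls (G : SimpleGraph V) (φ : Sym2 V → C) (c : C) : Set (Sym2 V) :=
  {e | e ∈ G.edgeSet ∧ φ e = c}

/-- `φ` is a (globally) `g`-bounded edge-colouring of `G`:
every colour is used on at most `g` edges. -/
def GBounded (G : SimpleGraph V) (φ : Sym2 V → C) (g : ℝ) : Prop :=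
  ∀ c : C, ((colourCls G φ c).ncard : ℝ) ≤ g

/-- `φ` is a locally `l`-bounded edge-colouring of `G`:
every vertex is incident to at most `l` edges of each colour. -/
def LBounded (G : SimpleGraph V) (φ : Sym2 V → C) (l : ℝ) : Prop :=
  ∀ (v : V) (c : C), (({u | G.Adj v u ∧ φ s(v, u) = c}).ncard : ℝ) ≤ l

/-- A set of edges is rainbow if the colouring is injective on it. -/
def Rainbow (φ : Sym2 V → C) (E : Set (Sym2 V)) : Prop :=
  Set.InjOn φ E

/-- The set of common neighbours `w` of `u` and `v` with `φ(uw) = φ(vw)`. -/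
def monoSet (G : SimpleGraph V) (φ : Sym2 V → C) (u v : V) : Set V :=
  {w | G.Adj u w ∧ G.Adj v w ∧ φ s(u, w) = φ s(v, w)}

/-- The monochromatic codegree `c^φ_G(u,v)`. -/
noncomputable def monoCodeg (G : SimpleGraph V) (φ : Sym2 V → C) (u v : V) : ℕ :=
  (monoSet G φ u v).ncard

/-- Degree of `u` into the set `S`. -/
noncomputable def degIn (G : SimpleGraph V) (u : V) (S : Set V) : ℕ :=
  (G.neighborSet u ∩ S).ncard

/-- Codegree of `u,v` into the set `S`. -/
noncomputable def codegIn (G : SimpleGraph V) (u v : V) (S : Set V) : ℕ :=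
  (G.neighborSet u ∩ G.neighborSet v ∩ S).ncard

/-- `G` restricted to `S` is `(ε,d)`-quasirandom: all degrees (within `S`)
are `(d ± ε)|S|` and all but at most `ε|S|²` unordered pairs of distinct
vertices of `S` have codegree (within `S`) equal to `(d² ± ε)|S|`. -/
def QuasirandomOn (G : SimpleGraph V) (S : Set V) (ε d : ℝ) : Prop :=
  (∀ v ∈ S, |(degIn G v S : ℝ) - d * S.ncard| ≤ ε * S.ncard) ∧
  ((({p : Sym2 V | ∃ u v, p = s(u, v) ∧ u ≠ v ∧ u ∈ S ∧ v ∈ S ∧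
        ¬ (|(codegIn G u v S : ℝ) - d ^ 2 * S.ncard| ≤ ε * S.ncard)}).ncard : ℝ)
      ≤ ε * (S.ncard : ℝ) ^ 2)

/-- `G` is `(ε,d)`-quasirandom. -/
def Quasirandom (G : SimpleGraph V) (ε d : ℝ) : Prop :=
  QuasirandomOn G Set.univ ε d

/-- Edges of `G` with one endpoint in `X` and the other in `Y`. -/
def edgesBetween (G : SimpleGraph V) (X Y : Set V) : Set (Sym2 V) :=
  {e | e ∈ G.edgeSet ∧ ∃ u v, e = s(u, v) ∧ u ∈ X ∧ v ∈ Y}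

/-- The pair `(A,B)` is `(ε,d)`-regular in `G`. -/
def RegularPair (G : SimpleGraph V) (A B : Set V) (ε d : ℝ) : Prop :=
  ∀ X ⊆ A, ∀ Y ⊆ B, ε * A.ncard ≤ (X.ncard : ℝ) → ε * B.ncard ≤ (Y.ncard : ℝ) →
    |((edgesBetween G X Y).ncard : ℝ) / ((X.ncard : ℝ) * (Y.ncard : ℝ)) - d| ≤ ε

/-- The pair `(A,B)` is `(ε,d)`-superregular in `G`. -/
def SuperregularPair (G : SimpleGraph V) (A B : Set V) (ε d : ℝ) : Prop :=
  RegularPair G A B ε d ∧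
  (∀ u ∈ A, |(degIn G u B : ℝ) - d * B.ncard| ≤ ε * B.ncard) ∧
  (∀ v ∈ B, |(degIn G v A : ℝ) - d * A.ncard| ≤ ε * A.ncard)

/-- `H` is a copy of `F`: a subgraph of `G` isomorphic to `F`. -/
def IsCopy (F : SimpleGraph W) {G : SimpleGraph V} (H : G.Subgraph) : Prop :=
  Nonempty (F ≃g H.coe)

/-- `L` is the union of the family `𝒞` of pairwise vertex-disjoint copies of `F`. -/
def IsFactorFrom (F : SimpleGraph W) {G : SimpleGraph V} (L : G.Subgraph)
    (𝒞 : Set G.Subgraph) : Prop :=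
  (∀ H ∈ 𝒞, IsCopy F H) ∧
  𝒞.Pairwise (fun H₁ H₂ => Disjoint H₁.verts H₂.verts) ∧
  L = sSup 𝒞

/-- `L` consists of vertex-disjoint copies of `F`. -/
def IsFFactorSub (F : SimpleGraph W) {G : SimpleGraph V} (L : G.Subgraph) : Prop :=
  ∃ 𝒞 : Set G.Subgraph, IsFactorFrom F L 𝒞

/-- An `ε`-decomposition: pairwise edge-disjoint subgraphs of `G` which together
contain all but at most an `ε`-proportion of the edges of `G`. -/
def ApxDecomp (G : SimpleGraph V) (ε : ℝ) {t : ℕ} (L : Fin t → G.Subgraph) : Prop :=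
  (Pairwise fun i j => Disjoint (L i).edgeSet (L j).edgeSet) ∧
  ((G.edgeSet \ ⋃ i, (L i).edgeSet).ncard : ℝ) ≤ ε * (G.edgeSet.ncard : ℝ)

/-- `a(F) ≤ a`, where `a(F) = max {Δ(F), a'(F), a''(F)}`. -/
def AParamLe (F : SimpleGraph W) (a : ℕ) : Prop :=
  (∀ v, (F.neighborSet v).ncard ≤ a) ∧
  (∀ u v, F.Adj u v →
    (F.neighborSet u).ncard + (F.neighborSet v).ncard - 2 ≤ a) ∧
  (∀ u v w, F.Adj u v → F.Adj v w → u ≠ w →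
    (F.neighborSet u).ncard + (F.neighborSet v).ncard + (F.neighborSet w).ncard - 4 ≤ a)

end Paper

open Paper

/-- The part `V_i` of the partition encoded by the assignment `σ`. -/
def part {n r : ℕ} (σ : Fin n → Option (Fin r)) (i : Fin r) : Set (Fin n) :=
  {v | σ v = some i}

/-- The probability of the assignment `σ` when each point is independently assigned
to part `i` with probability `p i` (and to no part with the remaining probability). -/
noncomputable def partWeight {n r : ℕ} (p : Fin r → ℝ)
    (σ : Fin n → Option (Fin r)) : ℝ :=
  ∏ v, ((σ v).elim (1 - ∑ i, p i) p)

section Counting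

lemma ncard_setOf_eq_sum {V : Type*} [Fintype V] (p : V → Prop) [DecidablePred p] :
    (({x | p x} : Set V).ncard : ℝ) = ∑ x, if p x then (1 : ℝ) else 0 := by
  rw [Set.ncard_eq_toFinset_card', Finset.sum_boole]
  congr 2
  ext x
  simp

/-- The `0`-`1` valued adjacency function of a graph. -/
noncomputable def adjInd {V : Type*} (G : SimpleGraph V) (u v : V) : ℝ :=
  open Classical in if G.Adj u v then 1 else 0

lemma adjInd_comm {V : Type*} (G : SimpleGraph V) (u v : V) :
    adjInd G u v = adjInd G v u := by
  classical
  rw [adjInd, adjInd]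
  exact if_congr (G.adj_comm u v) rfl rfl

lemma degIn_eq_sum {V : Type*} [Fintype V] (G : SimpleGraph V) (u : V) (B : Finset V) :
    (degIn G u (B : Set V) : ℝ) = ∑ y ∈ B, adjInd G u y := by
  classical
  have h : G.neighborSet u ∩ (B : Set V) = ((B.filter fun y => G.Adj u y : Finset V) : Set V) := by
    ext y; simp [and_comm]
  rw [degIn, h, Set.ncard_coe_finset]
  simp only [adjInd]
  rw [Finset.sum_boole]

lemma codegIn_eq_sum {V : Type*} [Fintype V] (G : SimpleGraph V) (u v : V) (B : Finset V) :
    (codegIn G u v (B : Set V) : ℝ) = ∑ y ∈ B, adjInd G u y * adjInd G v y := by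
  classical
  have h : G.neighborSet u ∩ G.neighborSet v ∩ (B : Set V) =
      ((B.filter fun y => G.Adj u y ∧ G.Adj v y : Finset V) : Set V) := by
    ext y; simp; tauto
  rw [codegIn, h, Set.ncard_coe_finset]
  simp only [adjInd, ite_mul, one_mul, zero_mul, ← ite_and]
  rw [Finset.sum_boole]

lemma codegIn_comm {V : Type*} (G : SimpleGraph V) (u v : V) (S : Set V) :
    codegIn G u v S = codegIn G v u S := by
  rw [codegIn, codegIn, Set.inter_comm (G.neighborSet u)]

lemma monoSet_comm {V C : Type*} (G : SimpleGraph V) (φ : Sym2 V → C) (u v : V) :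
    monoSet G φ u v = monoSet G φ v u := by
  ext w
  simp only [monoSet, Set.mem_ofPred_eq, eq_comm (a := φ s(u, w))]
  tauto

lemma monoCodeg_comm {V C : Type*} (G : SimpleGraph V) (φ : Sym2 V → C) (u v : V) :
    monoCodeg G φ u v = monoCodeg G φ v u := by
  rw [monoCodeg, monoSet_comm, monoCodeg]

lemma codegIn_le_ncard {V : Type*} [Finite V] (G : SimpleGraph V) (u v : V) (S : Set V) :
    codegIn G u v S ≤ S.ncard :=
  Set.ncard_le_ncard Set.inter_subset_right (Set.toFinite _)

open Classical in
/-- The degrees into `X` of the vertices of `B` have small variance if most pairs in `X` have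
codegree at most about `d ^ 2 * |B|`. -/
lemma sum_sq_degree_sub_le {V : Type*} [Fintype V] (G : SimpleGraph V) (X B : Finset V)
    {d γ t : ℝ} (hd0 : 0 ≤ d) (hd1 : d ≤ 1) (hγ : 0 ≤ γ)
    (hdeg : ∀ x ∈ X, d * B.card - γ * B.card ≤ (degIn G x (B : Set V) : ℝ))
    (ht : (((X ×ˢ X).filter fun q => ¬ ((codegIn G q.1 q.2 (B : Set V) : ℝ) ≤
      d ^ 2 * B.card + γ * B.card)).card : ℝ) ≤ t) :
    ∑ y ∈ B, ((∑ x ∈ X, adjInd G x y) - d * X.card) ^ 2 ≤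
      B.card * (3 * γ * (X.card : ℝ) ^ 2 + t) := by
  have hexp : ∑ y ∈ B, ((∑ x ∈ X, adjInd G x y) - d * X.card) ^ 2 =
      ∑ q ∈ X ×ˢ X, (codegIn G q.1 q.2 (B : Set V) : ℝ)
        - 2 * d * X.card * ∑ x ∈ X, (degIn G x (B : Set V) : ℝ)
        + d ^ 2 * (X.card : ℝ) ^ 2 * B.card := by
    have h1 : ∑ q ∈ X ×ˢ X, (codegIn G q.1 q.2 (B : Set V) : ℝ) =
        ∑ y ∈ B, (∑ x ∈ X, adjInd G x y) ^ 2 := by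
      simp only [codegIn_eq_sum]
      rw [Finset.sum_comm]
      refine Finset.sum_congr rfl fun y _ => ?_
      rw [sq, Finset.sum_mul_sum, Finset.sum_product]
    have h2 : ∑ x ∈ X, (degIn G x (B : Set V) : ℝ) = ∑ y ∈ B, ∑ x ∈ X, adjInd G x y := by
      simp only [degIn_eq_sum]
      rw [Finset.sum_comm]
    rw [h1, h2, Finset.mul_sum, ← Finset.sum_sub_distrib,
      show d ^ 2 * (X.card : ℝ) ^ 2 * B.card = ∑ y ∈ B, d ^ 2 * (X.card : ℝ) ^ 2 by
        rw [Finset.sum_const, nsmul_eq_mul]; ring,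
      ← Finset.sum_add_distrib]
    exact Finset.sum_congr rfl fun y _ => by ring
  have hB : (0 : ℝ) ≤ B.card := Nat.cast_nonneg _
  have hX : (0 : ℝ) ≤ X.card := Nat.cast_nonneg _
  have hcod : ∑ q ∈ X ×ˢ X, (codegIn G q.1 q.2 (B : Set V) : ℝ) ≤
      (X.card : ℝ) ^ 2 * (d ^ 2 * B.card + γ * B.card) + t * B.card := by
    calc ∑ q ∈ X ×ˢ X, (codegIn G q.1 q.2 (B : Set V) : ℝ)
        ≤ ∑ q ∈ X ×ˢ X, ((d ^ 2 * B.card + γ * B.card) +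
          if ¬ ((codegIn G q.1 q.2 (B : Set V) : ℝ) ≤ d ^ 2 * B.card + γ * B.card)
            then (B.card : ℝ) else 0) := by
          refine Finset.sum_le_sum fun q _ => ?_
          have h1 : (codegIn G q.1 q.2 (B : Set V) : ℝ) ≤ B.card := by
            exact_mod_cast (codegIn_le_ncard G q.1 q.2 (B : Set V)).trans_eq
              (Set.ncard_coe_finset B)
          have h2 : 0 ≤ d ^ 2 * B.card + γ * B.card := by positivity
          split_ifs <;> linarith
      _ ≤ _ := by
          rw [Finset.sum_add_distrib, Finset.sum_const, Finset.card_product, ← Finset.sum_filter,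
            Finset.sum_const, nsmul_eq_mul, nsmul_eq_mul]
          push_cast
          have := mul_le_mul_of_nonneg_right ht hB
          linarith
  have hdegs : (X.card : ℝ) * (d * B.card - γ * B.card) ≤
      ∑ x ∈ X, (degIn G x (B : Set V) : ℝ) := by
    rw [← nsmul_eq_mul]
    exact Finset.card_nsmul_le_sum _ _ _ hdeg
  have h3 := mul_le_mul_of_nonneg_left hdegs (show 0 ≤ 2 * d * X.card by positivity)
  have h4 : 2 * d * (γ * X.card ^ 2 * B.card) ≤ 2 * 1 * (γ * X.card ^ 2 * B.card) := by
    gcongr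
  rw [hexp]
  nlinarith

lemma ncard_edgesBetween {V : Type*} [Fintype V] (G : SimpleGraph V) (X Y : Finset V)
    (h : Disjoint X Y) :
    ((edgesBetween G (X : Set V) (Y : Set V)).ncard : ℝ) = ∑ y ∈ Y, ∑ x ∈ X, adjInd G x y := by
  classical
  have himg : edgesBetween G (X : Set V) (Y : Set V) =
      (fun q : V × V => s(q.1, q.2)) ''
        (((X ×ˢ Y).filter fun q => G.Adj q.1 q.2 : Finset (V × V)) : Set (V × V)) := by
    ext e
    simp only [edgesBetween, Set.mem_ofPred_eq, Set.mem_image, Finset.coe_filter,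
      Finset.mem_product, Finset.mem_coe, Prod.exists]
    constructor
    · rintro ⟨he, u, v, rfl, hu, hv⟩
      exact ⟨u, v, ⟨⟨hu, hv⟩, he⟩, rfl⟩
    · rintro ⟨u, v, ⟨⟨hu, hv⟩, he⟩, rfl⟩
      exact ⟨he, u, v, rfl, hu, hv⟩
  rw [himg, Set.InjOn.ncard_image, Set.ncard_coe_finset, Finset.sum_comm,
    ← Finset.sum_product']
  · simp only [adjInd]
    rw [Finset.sum_boole]
  · rintro ⟨a, b⟩ hab ⟨a', b'⟩ hab' heq
    simp only [Finset.coe_filter, Finset.mem_product, Set.mem_ofPred_eq] at hab hab'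
    simp only [Sym2.eq_iff] at heq
    rcases heq with ⟨rfl, rfl⟩ | ⟨rfl, rfl⟩
    · rfl
    · exact absurd hab'.1.2 (Finset.disjoint_left.1 h hab.1.1)

lemma regularPair_of_codegIn {V : Type*} [Fintype V] (G : SimpleGraph V) (A B : Set V)
    (hAB : Disjoint A B) {d κ ζ : ℝ} (hd0 : 0 ≤ d) (hd1 : d ≤ 1) (hκ : 0 ≤ κ)
    (hζ : 0 < ζ) (hζ1 : ζ ≤ 1) (hκζ : 4 * κ ≤ ζ ^ 4)
    (hA : 0 < A.ncard) (hB : 0 < B.ncard)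
    (hdeg : ∀ u ∈ A, |(degIn G u B : ℝ) - d * B.ncard| ≤ κ * B.ncard)
    (hcod : ∀ u ∈ A, (({v | v ∈ A ∧ ¬ |(codegIn G u v B : ℝ) - d ^ 2 * B.ncard| ≤
      κ * B.ncard} : Set V).ncard : ℝ) ≤ κ * A.ncard) :
    RegularPair G A B ζ d := by
  classical
  intro X hXA Y hYB hX hY
  obtain ⟨B, rfl⟩ := B.toFinite.exists_finset_coe
  obtain ⟨A, rfl⟩ := A.toFinite.exists_finset_coe
  obtain ⟨X, rfl⟩ := X.toFinite.exists_finset_coe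
  obtain ⟨Y, rfl⟩ := Y.toFinite.exists_finset_coe
  simp only [Set.ncard_coe_finset, Finset.coe_subset, Finset.disjoint_coe, Finset.mem_coe] at *
  have hA' : (0 : ℝ) < A.card := by exact_mod_cast hA
  have hB' : (0 : ℝ) < B.card := by exact_mod_cast hB
  have hX0 : (0 : ℝ) < X.card := lt_of_lt_of_le (by positivity) hX
  have hY0 : (0 : ℝ) < Y.card := lt_of_lt_of_le (by positivity) hY
  have hbad : (((X ×ˢ X).filter fun q => ¬ ((codegIn G q.1 q.2 (B : Set V) : ℝ) ≤
      d ^ 2 * B.card + κ * B.card)).card : ℝ) ≤ X.card * (κ * A.card) := by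
    rw [← Finset.sum_boole, Finset.sum_product, ← nsmul_eq_mul]
    refine Finset.sum_le_card_nsmul _ _ _ fun u hu => ?_
    refine le_trans ?_ (hcod u (hXA hu))
    rw [Finset.sum_boole, ← Set.ncard_coe_finset]
    refine Nat.cast_le.2 (Set.ncard_le_ncard ?_ (Set.toFinite _))
    intro v hv
    simp only [Finset.coe_filter, Set.mem_ofPred_eq] at hv ⊢
    refine ⟨hXA hv.1, fun h => hv.2 ?_⟩
    have := (abs_le.1 h).2
    linarith
  have hvar := sum_sq_degree_sub_le G X B hd0 hd1 hκ
    (fun x hx => by have := (abs_le.1 (hdeg x (hXA hx))).1; linarith) hbad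
  have hcs : ((∑ y ∈ Y, ∑ x ∈ X, adjInd G x y) - d * (X.card * Y.card)) ^ 2 ≤
      Y.card * (B.card * (3 * κ * (X.card : ℝ) ^ 2 + X.card * (κ * A.card))) := by
    have h1 : (∑ y ∈ Y, ∑ x ∈ X, adjInd G x y) - d * (X.card * Y.card) =
        ∑ y ∈ Y, ((∑ x ∈ X, adjInd G x y) - d * X.card) := by
      rw [Finset.sum_sub_distrib, Finset.sum_const, nsmul_eq_mul]; ring
    rw [h1]
    refine sq_sum_le_card_mul_sum_sq.trans ?_
    gcongr
    exact (Finset.sum_le_sum_of_subset_of_nonneg hYB fun _ _ _ => sq_nonneg _).trans hvar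
  have hfin : Y.card * (B.card * (3 * κ * (X.card : ℝ) ^ 2 + X.card * (κ * A.card))) ≤
      (ζ * (X.card * Y.card)) ^ 2 := by
    have e1 : ζ * (3 * κ * (X.card : ℝ) ^ 2 + X.card * (κ * A.card)) ≤
        4 * κ * (X.card : ℝ) ^ 2 := by
      have : κ * X.card * (ζ * A.card) ≤ κ * X.card * X.card := by gcongr
      have : κ * X.card ^ 2 * ζ ≤ κ * X.card ^ 2 * 1 := by gcongr
      nlinarith
    have e2 : (ζ * B.card) * (ζ * (3 * κ * (X.card : ℝ) ^ 2 + X.card * (κ * A.card))) ≤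
        Y.card * (ζ ^ 4 * (X.card : ℝ) ^ 2) := by
      refine mul_le_mul hY (e1.trans ?_) (by positivity) hY0.le
      gcongr
    have e3 : ζ ^ 2 * (B.card * (3 * κ * (X.card : ℝ) ^ 2 + X.card * (κ * A.card))) ≤
        ζ ^ 2 * (ζ ^ 2 * (X.card : ℝ) ^ 2 * Y.card) := by nlinarith
    have e4 := le_of_mul_le_mul_left e3 (by positivity)
    calc _ ≤ (Y.card : ℝ) * (ζ ^ 2 * (X.card : ℝ) ^ 2 * Y.card) := by gcongr
      _ = _ := by ring
  have habs := abs_le.1 (abs_le_of_sq_le_sq (hcs.trans hfin) (by positivity))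
  rw [ncard_edgesBetween G X Y (Finset.disjoint_of_subset_left hXA
    (Finset.disjoint_of_subset_right hYB hAB))]
  have hXY : (0 : ℝ) < X.card * Y.card := by positivity
  rw [abs_le]
  constructor
  · rw [neg_le_sub_iff_le_add, ← sub_le_iff_le_add, le_div_iff₀ hXY]
    nlinarith [habs.2, habs.1]
  · rw [sub_le_iff_le_add, div_le_iff₀ hXY]
    nlinarith [habs.2, habs.1]

end Counting

section Cleaning

lemma card_offDiag_le_two_mul_ncard_sym2 {V : Type*} [Fintype V] (P : V → V → Prop)
    [DecidablePred fun q : V × V => q.1 ≠ q.2 ∧ P q.1 q.2] :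
    (Finset.univ.filter fun q : V × V => q.1 ≠ q.2 ∧ P q.1 q.2).card ≤
      2 * ({e : Sym2 V | ∃ u v, e = s(u, v) ∧ u ≠ v ∧ P u v}).ncard := by
  classical
  set T := Finset.univ.filter fun q : V × V => q.1 ≠ q.2 ∧ P q.1 q.2 with hT
  have himg : ((T.image fun q => s(q.1, q.2) : Finset (Sym2 V)) : Set (Sym2 V)) =
      {e : Sym2 V | ∃ u v, e = s(u, v) ∧ u ≠ v ∧ P u v} := by
    ext e
    simp only [hT, Finset.coe_image, Finset.coe_filter, Finset.mem_univ, true_and, Set.mem_image,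
      Set.mem_ofPred_eq, Prod.exists]
    exact ⟨fun ⟨u, v, h, he⟩ => ⟨u, v, he.symm, h⟩, fun ⟨u, v, he, h⟩ => ⟨u, v, h, he.symm⟩⟩
  rw [← himg, Set.ncard_coe_finset]
  refine Finset.card_le_mul_card_image _ _ fun e _ => ?_
  induction e with
  | _ a b =>
    refine (Finset.card_le_card (t := {(a, b), (b, a)}) fun q hq => ?_).trans Finset.card_le_two
    obtain ⟨x, y⟩ := q
    simp only [Finset.mem_filter, Sym2.eq_iff] at hq
    simp only [Finset.mem_insert, Finset.mem_singleton, Prod.mk.injEq]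
    exact hq.2

lemma sum_monoCodeg_le {n m : ℕ} (G : SimpleGraph (Fin n)) (φ : Sym2 (Fin n) → Fin m) {l : ℝ}
    (hl : 0 ≤ l) (hφ : LBounded G φ l) (v : Fin n) :
    ∑ u, (monoCodeg G φ v u : ℝ) ≤ n * l := by
  classical
  simp only [monoCodeg, monoSet, ncard_setOf_eq_sum]
  rw [Finset.sum_comm]
  have key : ∀ w : Fin n, ∑ u, (if G.Adj v w ∧ G.Adj u w ∧ φ s(v, w) = φ s(u, w)
      then (1 : ℝ) else 0) ≤ l := by
    intro w
    by_cases hvw : G.Adj v w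
    · refine le_trans (le_of_eq ?_) (hφ w (φ s(v, w)))
      rw [ncard_setOf_eq_sum]
      refine Finset.sum_congr rfl fun u _ => if_congr ?_ rfl rfl
      rw [G.adj_comm w u, Sym2.eq_swap (a := w)]
      simp [hvw, eq_comm]
    · simpa [hvw] using hl
  calc _ ≤ ∑ _w : Fin n, l := Finset.sum_le_sum fun w _ => key w
    _ = _ := by simp

lemma mul_ncard_lt_le_sum {V : Type*} [Fintype V] (f : V → ℝ) (hf : ∀ x, 0 ≤ f x) {a : ℝ} :
    a * (({x | a < f x} : Set V).ncard : ℝ) ≤ ∑ x, f x := by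
  classical
  rw [ncard_setOf_eq_sum, Finset.mul_sum]
  refine Finset.sum_le_sum fun x _ => ?_
  split_ifs with h
  · linarith
  · simpa using hf x

lemma card_atypical_codegree_le {n : ℕ} (G : SimpleGraph (Fin n)) {d η β : ℝ}
    (hd0 : 0 ≤ d) (hd1 : d ≤ 1) (hη : 0 ≤ η) (hηβ : η ≤ β) (hβ : 0 < β)
    (hG : Quasirandom G η d) (hn : 1 ≤ η * n) (v : Fin n) :
    (({u | ¬ |(codegIn G v u Set.univ : ℝ) - d ^ 2 * n| ≤ 2 * β * n} : Set (Fin n)).ncard : ℝ)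
      * β ^ 2 ≤ 6 * η * n := by
  classical
  obtain ⟨hdeg, hcod⟩ := hG
  have hn0 : (0 : ℝ) < n := by
    rcases Nat.eq_zero_or_pos n with rfl | h
    · simp at hn; linarith
    · exact_mod_cast h
  simp only [Set.mem_univ, true_and, forall_const, Set.ncard_univ, Nat.card_eq_fintype_card,
    Fintype.card_fin] at hdeg hcod
  set X := Finset.univ.filter fun u => G.Adj v u with hX
  have hXc : degIn G v Set.univ = X.card := by
    rw [degIn, ← Set.ncard_coe_finset]
    congr 1
    ext u; simp [hX]
  have hXn : (X.card : ℝ) ≤ n := by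
    have := Finset.card_le_univ X
    rw [Fintype.card_fin] at this
    exact_mod_cast this
  have hbad : (((X ×ˢ X).filter fun q => ¬ ((codegIn G q.1 q.2
      ((Finset.univ : Finset (Fin n)) : Set (Fin n)) : ℝ) ≤
      d ^ 2 * (Finset.univ : Finset (Fin n)).card + η * (Finset.univ : Finset (Fin n)).card)).card
      : ℝ) ≤ 3 * η * n ^ 2 := by
    have h1 := card_offDiag_le_two_mul_ncard_sym2
      fun u v : Fin n => ¬ |(codegIn G u v Set.univ : ℝ) - d ^ 2 * n| ≤ η * n
    have h2 : ((X ×ˢ X).filter fun q => ¬ ((codegIn G q.1 q.2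
      ((Finset.univ : Finset (Fin n)) : Set (Fin n)) : ℝ) ≤
      d ^ 2 * (Finset.univ : Finset (Fin n)).card + η * (Finset.univ : Finset (Fin n)).card)) ⊆
      (Finset.univ.filter fun q : Fin n × Fin n => q.1 ≠ q.2 ∧
        ¬ |(codegIn G q.1 q.2 Set.univ : ℝ) - d ^ 2 * n| ≤ η * n) ∪
      (Finset.univ : Finset (Fin n)).image fun u => (u, u) := by
      intro q hq
      simp only [Finset.mem_filter, Finset.coe_univ, Finset.card_univ, Fintype.card_fin] at hq
      simp only [Finset.mem_union, Finset.mem_filter, Finset.mem_univ, true_and,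
        Finset.mem_image]
      by_cases hq' : q.1 = q.2
      · exact Or.inr ⟨q.1, by ext <;> simp [hq']⟩
      · refine Or.inl ⟨hq', fun h => hq.2 ?_⟩
        have := (abs_le.1 h).2
        linarith
    have h3 := (Finset.card_le_card h2).trans (Finset.card_union_le _ _)
    have h4 : ((Finset.univ : Finset (Fin n)).image fun u => (u, u)).card ≤ n :=
      Finset.card_image_le.trans (by simp)
    have h5 := (h3.trans (Nat.add_le_add h1 h4))
    have h6 : (((X ×ˢ X).filter fun q => ¬ ((codegIn G q.1 q.2
      ((Finset.univ : Finset (Fin n)) : Set (Fin n)) : ℝ) ≤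
      d ^ 2 * (Finset.univ : Finset (Fin n)).card + η * (Finset.univ : Finset (Fin n)).card)).card
      : ℝ) ≤ 2 * (({e : Sym2 (Fin n) | ∃ u v, e = s(u, v) ∧ u ≠ v ∧
        ¬ |(codegIn G u v Set.univ : ℝ) - d ^ 2 * n| ≤ η * n} : Set (Sym2 (Fin n))).ncard : ℝ)
        + n := by exact_mod_cast h5
    have h7 : (n : ℝ) * 1 ≤ n * (η * n) := by gcongr
    linarith
  have hvar := sum_sq_degree_sub_le G X Finset.univ hd0 hd1 hη
    (fun x _ => by
      have := (abs_le.1 (hdeg x)).1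
      simp only [Finset.coe_univ, Finset.card_univ, Fintype.card_fin]
      linarith) hbad
  simp only [Finset.card_univ, Fintype.card_fin] at hvar
  have hvar' : ∑ u, ((∑ x ∈ X, adjInd G x u) - d * X.card) ^ 2 ≤ 6 * η * n ^ 3 := by
    refine hvar.trans ?_
    have : (n : ℝ) * (3 * η * (X.card : ℝ) ^ 2 + 3 * η * n ^ 2) ≤
      n * (3 * η * (n : ℝ) ^ 2 + 3 * η * n ^ 2) := by gcongr
    linarith
  have hmark := mul_ncard_lt_le_sum (fun u => ((∑ x ∈ X, adjInd G x u) - d * X.card) ^ 2)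
    (fun u => sq_nonneg _) (a := (β * n) ^ 2)
  have hsub : ({u | ¬ |(codegIn G v u Set.univ : ℝ) - d ^ 2 * n| ≤ 2 * β * n} : Set (Fin n)) ⊆
      {u | (β * n) ^ 2 < ((∑ x ∈ X, adjInd G x u) - d * X.card) ^ 2} := by
    intro u hu
    simp only [Set.mem_ofPred_eq] at hu ⊢
    by_contra hcon
    apply hu
    push Not at hcon
    have h1 := abs_le_of_sq_le_sq hcon (by positivity)
    have h2 : ∑ x ∈ X, adjInd G x u = (codegIn G v u Set.univ : ℝ) := by
      rw [← Finset.coe_univ, codegIn_eq_sum, hX, Finset.sum_filter]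
      refine Finset.sum_congr rfl fun x _ => ?_
      rw [adjInd_comm G u x, adjInd, adjInd]
      split_ifs <;> simp
    rw [h2] at h1
    have h3 := hdeg v
    rw [hXc] at h3
    have h4 : |d * ((X.card : ℝ) - d * n)| ≤ β * n := by
      rw [abs_mul, abs_of_nonneg hd0]
      calc _ ≤ 1 * (η * (n : ℝ)) := mul_le_mul hd1 h3 (abs_nonneg _) zero_le_one
        _ ≤ _ := by rw [one_mul]; gcongr
    rw [abs_le] at h1 h4 ⊢
    constructor <;> nlinarith
  have hle : (({u | ¬ |(codegIn G v u Set.univ : ℝ) - d ^ 2 * n| ≤ 2 * β * n}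
      : Set (Fin n)).ncard : ℝ) ≤
      (({u | (β * n) ^ 2 < ((∑ x ∈ X, adjInd G x u) - d * X.card) ^ 2} : Set (Fin n)).ncard : ℝ) :=
    Nat.cast_le.2 (Set.ncard_le_ncard hsub (Set.toFinite _))
  have h8 := (mul_le_mul_of_nonneg_left hle (sq_nonneg (β * n))).trans (hmark.trans hvar')
  have h9 : (n : ℝ) ^ 2 * ((({u | ¬ |(codegIn G v u Set.univ : ℝ) - d ^ 2 * n| ≤ 2 * β * n}
      : Set (Fin n)).ncard : ℝ) * β ^ 2) ≤ n ^ 2 * (6 * η * n) := by linarith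
  exact le_of_mul_le_mul_left h9 (by positivity)

/-- Deleting the edges with atypical codegree or large monochromatic codegree changes every degree
and every codegree only slightly. -/
lemma exists_typical_subgraph {d α : ℝ} (hd0 : 0 ≤ d) (hd1 : d ≤ 1) (hα : 0 < α) (hα1 : α ≤ 1) :
    ∃ η₀ : ℝ, 0 < η₀ ∧ ∀ η : ℝ, 0 < η → η ≤ η₀ → ∃ n₀ : ℕ, ∀ n : ℕ, n₀ ≤ n →
    ∀ (G' : SimpleGraph (Fin n)) (m : ℕ) (φ : Sym2 (Fin n) → Fin m),
      Quasirandom G' η d → LBounded G' φ (η * n) →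
      ∃ G : SimpleGraph (Fin n), G ≤ G' ∧
        (∀ v, |(degIn G v Set.univ : ℝ) - d * n| ≤ α * n) ∧
        (∀ v, (({u | ¬ |(codegIn G v u Set.univ : ℝ) - d ^ 2 * n| ≤ α * n}
          : Set (Fin n)).ncard : ℝ) ≤ α * n) ∧
        (∀ u v : Fin n, G.Adj u v →
          |(codegIn G u v Set.univ : ℝ) - d ^ 2 * n| ≤ α * n ∧
          (monoCodeg G φ u v : ℝ) ≤ α * n) := by
  set β := α / 6 with hβdef
  have hβ : 0 < β := by positivity
  have hβ1 : β ≤ 1 := by rw [hβdef]; linarith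
  refine ⟨β ^ 3 / 6, by positivity, fun η hη hηβ => ⟨⌈1 / η⌉₊, fun n hn G' m φ hG' hφ => ?_⟩⟩
  have hn1 : 1 ≤ η * n := by
    have := Nat.ceil_le.1 hn
    rw [div_le_iff₀ hη] at this
    linarith
  have hn0 : (0 : ℝ) < n := by
    by_contra h
    have := mul_nonpos_of_nonneg_of_nonpos hη.le (not_lt.1 h)
    linarith
  have hη2 : η ≤ β ^ 2 := by
    have : β ^ 3 ≤ β ^ 2 := pow_le_pow_of_le_one hβ.le hβ1 (by norm_num)
    have : 0 ≤ β ^ 3 := by positivity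
    linarith
  have hη1 : η ≤ β := hη2.trans (by nlinarith)
  let P : Fin n → Fin n → Prop := fun u v =>
    ¬ |(codegIn G' u v Set.univ : ℝ) - d ^ 2 * n| ≤ 2 * β * n ∨ β * n < (monoCodeg G' φ u v : ℝ)
  have hPsymm : ∀ u v, P u v → P v u := by
    intro u v h
    simpa only [P, codegIn_comm G' v u, monoCodeg_comm G' φ v u] using h
  let D : Fin n → Set (Fin n) := fun v => {u | P v u}
  let D₁ : Fin n → Set (Fin n) := fun v =>
    {u | ¬ |(codegIn G' v u Set.univ : ℝ) - d ^ 2 * n| ≤ 2 * β * n}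
  have hD₁ : ∀ v, ((D₁ v).ncard : ℝ) ≤ β * n := by
    intro v
    have h1 := card_atypical_codegree_le G' hd0 hd1 hη.le hη1 hβ hG' hn1 v
    have h2 : 6 * η * n ≤ β ^ 3 * n := by gcongr; linarith
    have h3 : β ^ 2 * ((D₁ v).ncard : ℝ) ≤ β ^ 2 * (β * n) := by
      have := h1.trans h2
      simp only [D₁]
      linarith
    exact le_of_mul_le_mul_left h3 (by positivity)
  have hD₂ : ∀ v, (({u | β * n < (monoCodeg G' φ v u : ℝ)} : Set (Fin n)).ncard : ℝ) ≤ β * n := by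
    intro v
    have h1 := (mul_ncard_lt_le_sum (fun u => (monoCodeg G' φ v u : ℝ))
      (fun u => Nat.cast_nonneg _) (a := β * n)).trans
      (sum_monoCodeg_le G' φ (by positivity) hφ v)
    have h2 : (n : ℝ) * (η * n) ≤ n * (β ^ 2 * n) := by gcongr
    have h3 : β * n * (({u | β * n < (monoCodeg G' φ v u : ℝ)} : Set (Fin n)).ncard : ℝ) ≤
      β * n * (β * n) := by linarith
    exact le_of_mul_le_mul_left h3 (by positivity)
  have hD : ∀ v, ((D v).ncard : ℝ) ≤ 2 * β * n := by
    intro v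
    have h1 : D v = D₁ v ∪ {u | β * n < (monoCodeg G' φ v u : ℝ)} := by
      ext u; simp [D, D₁, P]
    have h2 : ((D v).ncard : ℝ) ≤ (D₁ v).ncard +
        ({u | β * n < (monoCodeg G' φ v u : ℝ)} : Set (Fin n)).ncard := by
      rw [h1]; exact_mod_cast Set.ncard_union_le _ _
    linarith [hD₁ v, hD₂ v]
  let G : SimpleGraph (Fin n) :=
    { Adj := fun u v => G'.Adj u v ∧ ¬ P u v
      symm := ⟨fun u v h => ⟨h.1.symm, fun h' => h.2 (hPsymm _ _ h')⟩⟩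
      loopless := ⟨fun u h => G'.loopless.irrefl u h.1⟩ }
  have hle : G ≤ G' := fun u v h => h.1
  have hnbr : ∀ v, G'.neighborSet v ⊆ G.neighborSet v ∪ D v := by
    intro v u hu
    by_cases h : P v u
    · exact Or.inr h
    · exact Or.inl ⟨hu, h⟩
  have hnbr' : ∀ v, G.neighborSet v ⊆ G'.neighborSet v := fun v u hu => hu.1
  have hcod1 : ∀ u v, codegIn G u v Set.univ ≤ codegIn G' u v Set.univ := by
    intro u v
    exact Set.ncard_le_ncard (Set.inter_subset_inter_left _
      (Set.inter_subset_inter (hnbr' u) (hnbr' v))) (Set.toFinite _)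
  have hcod2 : ∀ u v, (codegIn G' u v Set.univ : ℝ) ≤ codegIn G u v Set.univ + 4 * β * n := by
    intro u v
    have h1 : G'.neighborSet u ∩ G'.neighborSet v ∩ Set.univ ⊆
        (G.neighborSet u ∩ G.neighborSet v ∩ Set.univ) ∪ (D u ∪ D v) := by
      rintro w ⟨⟨hu, hv⟩, -⟩
      have := hnbr u hu
      have := hnbr v hv
      simp only [Set.mem_union, Set.mem_inter_iff, Set.mem_univ, and_true] at *
      tauto
    have h2 := (Set.ncard_le_ncard h1 (Set.toFinite _)).trans
      ((Set.ncard_union_le _ _).trans (Nat.add_le_add_left (Set.ncard_union_le _ _) _))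
    have h3 : (codegIn G' u v Set.univ : ℝ) ≤
      codegIn G u v Set.univ + ((D u).ncard + (D v).ncard) := by exact_mod_cast h2
    linarith [hD u, hD v]
  have hcod : ∀ u v, |(codegIn G' u v Set.univ : ℝ) - d ^ 2 * n| ≤ 2 * β * n →
      |(codegIn G u v Set.univ : ℝ) - d ^ 2 * n| ≤ α * n := by
    intro u v h
    have h1 : (codegIn G u v Set.univ : ℝ) ≤ codegIn G' u v Set.univ := by
      exact_mod_cast hcod1 u v
    have h2 := hcod2 u v
    have h3 : α * n = 6 * β * n := by rw [hβdef]; ring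
    have h4 : 0 ≤ β * n := by positivity
    rw [abs_le] at h ⊢
    constructor <;> linarith
  refine ⟨G, hle, fun v => ?_, fun v => ?_, fun u v huv => ⟨?_, ?_⟩⟩
  · have h1 : (degIn G v Set.univ : ℝ) ≤ degIn G' v Set.univ := by
      exact_mod_cast Set.ncard_le_ncard (Set.inter_subset_inter_left _ (hnbr' v)) (Set.toFinite _)
    have h2 : (degIn G' v Set.univ : ℝ) ≤ degIn G v Set.univ + (D v).ncard := by
      simp only [degIn, Set.inter_univ]
      exact_mod_cast (Set.ncard_le_ncard (hnbr v) (Set.toFinite _)).trans (Set.ncard_union_le _ _)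
    have h3 := hG'.1 v (Set.mem_univ v)
    simp only [Set.ncard_univ, Nat.card_eq_fintype_card, Fintype.card_fin] at h3
    have h4 := hD v
    have h5 : α * n = 6 * β * n := by rw [hβdef]; ring
    have h6 : η * n ≤ β * n := by gcongr
    have h7 : 0 ≤ β * n := by positivity
    rw [abs_le] at h3 ⊢
    constructor <;> linarith
  · have h1 : ({u | ¬ |(codegIn G v u Set.univ : ℝ) - d ^ 2 * n| ≤ α * n} : Set (Fin n)) ⊆ D₁ v :=
      fun u hu h => hu (hcod v u h)
    have h2 : (({u | ¬ |(codegIn G v u Set.univ : ℝ) - d ^ 2 * n| ≤ α * n}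
        : Set (Fin n)).ncard : ℝ) ≤ (D₁ v).ncard :=
      Nat.cast_le.2 (Set.ncard_le_ncard h1 (Set.toFinite _))
    have h3 : β * n ≤ α * n := by gcongr; rw [hβdef]; linarith
    linarith [hD₁ v]
  · exact hcod u v (not_not.1 fun h => huv.2 (Or.inl h))
  · have h1 : (monoCodeg G φ u v : ℝ) ≤ monoCodeg G' φ u v :=
      Nat.cast_le.2 (Set.ncard_le_ncard (fun w hw => ⟨hw.1.1, hw.2.1.1, hw.2.2⟩) (Set.toFinite _))
    have h2 : (monoCodeg G' φ u v : ℝ) ≤ β * n := not_lt.1 fun h => huv.2 (Or.inr h)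
    have h3 : β * n ≤ α * n := by gcongr; rw [hβdef]; linarith
    linarith

end Cleaning

section RandomPartition

lemma sum_prod_apply {n : ℕ} {κ : Type*} [Fintype κ] (g : Fin n → κ → ℝ) :
    ∑ σ : Fin n → κ, ∏ v, g v (σ v) = ∏ v, ∑ o, g v o := by
  classical
  rw [Finset.prod_univ_sum, Fintype.piFinset_univ]

lemma sum_elim_eq_one {r : ℕ} (p : Fin r → ℝ) :
    ∑ o : Option (Fin r), o.elim (1 - ∑ i, p i) p = 1 := by
  simp [Fintype.sum_option]

lemma sum_partWeight {n r : ℕ} (p : Fin r → ℝ) :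
    ∑ σ : Fin n → Option (Fin r), partWeight p σ = 1 := by
  simp only [partWeight]
  rw [sum_prod_apply fun _ o => Option.elim o (1 - ∑ i, p i) p]
  simp only [sum_elim_eq_one, Finset.prod_const_one]

lemma partWeight_nonneg {n r : ℕ} {p : Fin r → ℝ} (hp : ∀ i, 0 ≤ p i) (hsum : ∑ i, p i ≤ 1)
    (σ : Fin n → Option (Fin r)) : 0 ≤ partWeight p σ := by
  refine Finset.prod_nonneg fun v _ => ?_
  cases σ v with
  | none => simpa using hsum
  | some i => exact hp i

lemma sum_partWeight_mul_exp_le {n r : ℕ} {p : Fin r → ℝ} (hp : ∀ i, 0 ≤ p i)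
    (hsum : ∑ i, p i ≤ 1) (S : Set (Fin n)) (i : Fin r) {l : ℝ} (hl : |l| ≤ 1) :
    ∑ σ : Fin n → Option (Fin r), partWeight p σ *
      Real.exp (l * (((S ∩ part σ i).ncard : ℝ) - p i * S.ncard)) ≤
      Real.exp (l ^ 2 * (p i * n)) := by
  classical
  have hcard : ∀ σ : Fin n → Option (Fin r),
      l * (((S ∩ part σ i).ncard : ℝ) - p i * S.ncard) =
      ∑ v, l * ((if v ∈ S ∧ σ v = some i then 1 else 0) - p i * if v ∈ S then 1 else 0) := by
    intro σ
    rw [← Finset.mul_sum, Finset.sum_sub_distrib, ← Finset.mul_sum, ← ncard_setOf_eq_sum,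
      ← ncard_setOf_eq_sum]
    rfl
  simp only [hcard, Real.exp_sum, partWeight, ← Finset.prod_mul_distrib]
  rw [sum_prod_apply fun v o => Option.elim o (1 - ∑ i, p i) p *
    Real.exp (l * ((if v ∈ S ∧ o = some i then 1 else 0) - p i * if v ∈ S then 1 else 0))]
  have hfac : ∀ v : Fin n, ∑ o : Option (Fin r), Option.elim o (1 - ∑ i, p i) p *
      Real.exp (l * ((if v ∈ S ∧ o = some i then 1 else 0) - p i * if v ∈ S then 1 else 0)) =
      if v ∈ S then (1 + p i * (Real.exp l - 1)) * Real.exp (-(l * p i)) else 1 := by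
    intro v
    by_cases hv : v ∈ S
    · have h1 : ∀ j : Fin r, p j * Real.exp (l * ((if j = i then 1 else 0) - p i)) =
          (p j + if j = i then p i * (Real.exp l - 1) else 0) * Real.exp (-(l * p i)) := by
        intro j
        rw [mul_sub, sub_eq_add_neg, Real.exp_add]
        split_ifs with h
        · subst h; rw [mul_one]; ring
        · rw [mul_zero, Real.exp_zero]; ring
      simp only [hv, true_and, if_true, mul_one, Fintype.sum_option, Option.elim, reduceCtorEq,
        if_false, Option.some.injEq, h1]
      rw [← Finset.sum_mul, Finset.sum_add_distrib, Finset.sum_ite_eq' Finset.univ i]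
      simp only [Finset.mem_univ, if_true, zero_sub, mul_neg]
      ring
    · simp [hv]
  simp only [hfac]
  rw [show l ^ 2 * (p i * n) = ∑ _v : Fin n, l ^ 2 * p i by simp; ring, Real.exp_sum]
  have hexp : Real.exp l - 1 - l ≤ l ^ 2 := (abs_le.1 (Real.abs_exp_sub_one_sub_id_le hl)).2
  have hpi := hp i
  have hp1 : p i ≤ 1 := (Finset.single_le_sum (fun j _ => hp j) (Finset.mem_univ i)).trans hsum
  have h2 := Real.add_one_le_exp (p i * (Real.exp l - 1))
  refine Finset.prod_le_prod (fun v _ => ?_) fun v _ => ?_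
  · split_ifs
    · have h3 := Real.exp_pos l
      have h4 : 0 ≤ 1 + p i * (Real.exp l - 1) := by nlinarith [mul_nonneg hpi h3.le]
      positivity
    · exact zero_le_one
  · split_ifs
    · calc (1 + p i * (Real.exp l - 1)) * Real.exp (-(l * p i))
          ≤ Real.exp (p i * (Real.exp l - 1)) * Real.exp (-(l * p i)) := by
            gcongr; linarith
        _ = Real.exp ((Real.exp l - 1 - l) * p i) := by
            rw [← Real.exp_add]; congr 1; ring
        _ ≤ _ := by gcongr
    · exact Real.one_le_exp (by positivity)

/-- A union bound over the members of a family `S` of sets and over the parts. -/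
lemma le_sum_indicator_partWeight {n r : ℕ} {ι : Type*} [Fintype ι] {p : Fin r → ℝ}
    (hp : ∀ i, 0 ≤ p i) (hsum : ∑ i, p i ≤ 1) (S : ι → Set (Fin n)) {γ : ℝ}
    (hγ : 0 < γ) (hγ1 : γ ≤ 1) (E : Set (Fin n → Option (Fin r)))
    (hE : ∀ σ, (∀ k i, |((S k ∩ part σ i).ncard : ℝ) - p i * (S k).ncard| ≤ γ * (p i * n)) →
      σ ∈ E) :
    1 - Fintype.card ι * ∑ i, 2 * Real.exp (-(γ ^ 2 / 4 * (p i * n))) ≤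
      ∑ σ, Set.indicator E (partWeight p) σ := by
  let Y : ι → Fin r → (Fin n → Option (Fin r)) → ℝ := fun k i σ =>
    ((S k ∩ part σ i).ncard : ℝ) - p i * (S k).ncard
  let F : ι → Fin r → (Fin n → Option (Fin r)) → ℝ := fun k i σ =>
    (Real.exp (γ / 2 * Y k i σ) + Real.exp (-(γ / 2) * Y k i σ)) *
      Real.exp (-(γ / 2 * (γ * (p i * n))))
  have hF : ∀ k i σ, 0 ≤ F k i σ := fun k i σ => by positivity
  have hpoint : ∀ σ, partWeight p σ ≤
      Set.indicator E (partWeight p) σ + ∑ k, ∑ i, partWeight p σ * F k i σ := by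
    intro σ
    have hw := partWeight_nonneg hp hsum σ
    have hnn : ∀ k i, 0 ≤ partWeight p σ * F k i σ := fun k i => mul_nonneg hw (hF k i σ)
    by_cases hσ : σ ∈ E
    · rw [Set.indicator_of_mem hσ]
      have := Finset.sum_nonneg fun k (_ : k ∈ Finset.univ) =>
        Finset.sum_nonneg fun i (_ : i ∈ Finset.univ) => hnn k i
      linarith
    · rw [Set.indicator_of_notMem hσ, zero_add]
      have : ∃ k i, γ * (p i * n) < |Y k i σ| := by
        by_contra! h
        exact hσ (hE σ h)
      obtain ⟨k, i, hki⟩ := this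
      have hF1 : 1 ≤ F k i σ := by
        have hmul := mul_lt_mul_of_pos_left hki (half_pos hγ)
        have he1 := Real.exp_pos (γ / 2 * Y k i σ)
        have he2 := Real.exp_pos (-(γ / 2) * Y k i σ)
        have hle : Real.exp (γ / 2 * (γ * (p i * n))) ≤
            Real.exp (γ / 2 * Y k i σ) + Real.exp (-(γ / 2) * Y k i σ) := by
          rcases abs_cases (Y k i σ) with ⟨h, -⟩ | ⟨h, -⟩
          · have := Real.exp_le_exp.2 (show γ / 2 * (γ * (p i * n)) ≤ γ / 2 * Y k i σ by
              rw [← h]; exact hmul.le)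
            linarith
          · have := Real.exp_le_exp.2 (show γ / 2 * (γ * (p i * n)) ≤ -(γ / 2) * Y k i σ by
              rw [neg_mul, ← mul_neg, ← h]; exact hmul.le)
            linarith
        calc (1 : ℝ) = Real.exp (γ / 2 * (γ * (p i * n))) *
              Real.exp (-(γ / 2 * (γ * (p i * n)))) := by
              rw [← Real.exp_add, add_neg_cancel, Real.exp_zero]
          _ ≤ F k i σ := mul_le_mul_of_nonneg_right hle (Real.exp_pos _).le
      calc partWeight p σ = partWeight p σ * 1 := (mul_one _).symm
        _ ≤ partWeight p σ * F k i σ := mul_le_mul_of_nonneg_left hF1 hw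
        _ ≤ ∑ i, partWeight p σ * F k i σ :=
            Finset.single_le_sum (f := fun i => partWeight p σ * F k i σ) (fun i _ => hnn k i)
              (Finset.mem_univ i)
        _ ≤ _ := Finset.single_le_sum (f := fun k => ∑ i, partWeight p σ * F k i σ)
            (fun k _ => Finset.sum_nonneg fun i _ => hnn k i) (Finset.mem_univ k)
  have hexpect : ∀ k i, ∑ σ, partWeight p σ * F k i σ ≤
      2 * Real.exp (-(γ ^ 2 / 4 * (p i * n))) := by
    intro k i
    have habs : |γ / 2| ≤ 1 := by rw [abs_of_pos (half_pos hγ)]; linarith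
    have h1 := sum_partWeight_mul_exp_le hp hsum (S k) i habs
    have h2 := sum_partWeight_mul_exp_le hp hsum (S k) i (l := -(γ / 2)) (by rwa [abs_neg])
    rw [neg_sq] at h2
    have h3 : ∑ σ, partWeight p σ * F k i σ =
        (∑ σ, partWeight p σ * Real.exp (γ / 2 * Y k i σ) +
          ∑ σ, partWeight p σ * Real.exp (-(γ / 2) * Y k i σ)) *
        Real.exp (-(γ / 2 * (γ * (p i * n)))) := by
      rw [← Finset.sum_add_distrib, Finset.sum_mul]
      exact Finset.sum_congr rfl fun σ _ => by simp only [F]; ring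
    rw [h3]
    calc _ ≤ (Real.exp ((γ / 2) ^ 2 * (p i * n)) + Real.exp ((γ / 2) ^ 2 * (p i * n))) *
          Real.exp (-(γ / 2 * (γ * (p i * n)))) :=
          mul_le_mul_of_nonneg_right (add_le_add h1 h2) (Real.exp_pos _).le
      _ = _ := by
          rw [← two_mul, mul_assoc, ← Real.exp_add]
          congr 2
          ring
  have htot := Finset.sum_le_sum fun σ (_ : σ ∈ Finset.univ) => hpoint σ
  rw [sum_partWeight, Finset.sum_add_distrib, Finset.sum_comm] at htot
  have hbound : ∑ k : ι, ∑ σ, ∑ i, partWeight p σ * F k i σ ≤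
      Fintype.card ι * ∑ i, 2 * Real.exp (-(γ ^ 2 / 4 * (p i * n))) := by
    rw [← nsmul_eq_mul]
    refine Finset.sum_le_card_nsmul _ _ _ fun k _ => ?_
    rw [Finset.sum_comm]
    exact Finset.sum_le_sum fun i _ => hexpect k i
  linarith

lemma exists_forall_pow_mul_exp_le {c : ℝ} (hc : 0 < c) :
    ∃ n₀ : ℕ, ∀ n : ℕ, n₀ ≤ n → 8 * (n : ℝ) ^ 3 * Real.exp (-(c * √n)) ≤ 0.1 := by
  have h1 := tendsto_rpow_mul_exp_neg_mul_atTop_nhds_zero 6 c hc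
  have h2 : Filter.Tendsto (fun n : ℕ => √(n : ℝ)) Filter.atTop Filter.atTop :=
    Real.tendsto_sqrt_atTop.comp tendsto_natCast_atTop_atTop
  have h3 := (h1.comp h2).eventually (ge_mem_nhds (show (0 : ℝ) < 1 / 80 by norm_num))
  obtain ⟨n₀, hn₀⟩ := Filter.eventually_atTop.1 h3
  refine ⟨n₀, fun n hn => ?_⟩
  have h4 := hn₀ n hn
  simp only [Function.comp_apply] at h4
  have h5 : √(n : ℝ) ^ (6 : ℝ) = (n : ℝ) ^ 3 := by
    rw [show (6 : ℝ) = ((6 : ℕ) : ℝ) by norm_num, Real.rpow_natCast, pow_mul (√(n : ℝ)) 2 3,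
      Real.sq_sqrt (Nat.cast_nonneg n)]
  rw [h5, neg_mul] at h4
  linarith

/-- With probability at least `0.9`, a random partition splits every member of a family of
at most `4 * n ^ 2` sets proportionally. -/
lemma exists_forall_le_sum_indicator_partWeight {γ : ℝ} (hγ : 0 < γ) (hγ1 : γ ≤ 1) :
    ∃ n₀ : ℕ, ∀ n : ℕ, n₀ ≤ n → ∀ (ι : Type) [Fintype ι] (S : ι → Set (Fin n)),
      Fintype.card ι ≤ 4 * n ^ 2 → ∀ (r : ℕ) (p : Fin r → ℝ),
      (∀ i, (n : ℝ) ^ (-(1 : ℝ) / 2) ≤ p i) → ∑ i, p i ≤ 1 →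
      ∀ E : Set (Fin n → Option (Fin r)),
      (∀ σ, (∀ k i, |((S k ∩ part σ i).ncard : ℝ) - p i * (S k).ncard| ≤ γ * (p i * n)) →
        σ ∈ E) →
      (0.9 : ℝ) ≤ ∑ σ, Set.indicator E (partWeight p) σ := by
  obtain ⟨n₀, hn₀⟩ := exists_forall_pow_mul_exp_le (show 0 < γ ^ 2 / 4 by positivity)
  refine ⟨max n₀ 1, fun n hn ι _ S hι r p hp hsum E hE => ?_⟩
  have hn1 : (1 : ℝ) ≤ n := by exact_mod_cast (le_max_right _ _).trans hn
  have hn0 : (0 : ℝ) < n := by linarith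
  have hrpow : (n : ℝ) ^ (-(1 : ℝ) / 2) = (√n)⁻¹ := by
    rw [neg_div, Real.rpow_neg hn0.le, Real.sqrt_eq_rpow]
  simp only [hrpow] at hp
  have hs : 0 < √(n : ℝ) := Real.sqrt_pos.2 hn0
  have hss : √(n : ℝ) * √n = n := Real.mul_self_sqrt hn0.le
  have hr : (r : ℝ) ≤ n := by
    have h1 : (r : ℝ) * (√(n : ℝ))⁻¹ ≤ 1 := by
      refine le_trans ?_ hsum
      simpa using Finset.card_nsmul_le_sum Finset.univ p _ fun i _ => hp i
    rw [← div_eq_mul_inv, div_le_one hs] at h1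
    have h2 : 1 ≤ √(n : ℝ) := Real.one_le_sqrt.2 hn1
    nlinarith
  have hp0 : ∀ i, 0 ≤ p i := fun i => (inv_nonneg.2 hs.le).trans (hp i)
  refine le_trans ?_ (le_sum_indicator_partWeight hp0 hsum S hγ hγ1 E hE)
  have hpn : ∀ i, √(n : ℝ) ≤ p i * n := by
    intro i
    calc √(n : ℝ) = (√(n : ℝ))⁻¹ * n := by
          nth_rewrite 3 [← hss]; rw [inv_mul_cancel_left₀ hs.ne']
      _ ≤ _ := by gcongr; exact hp i
  have hsum' : ∑ i, 2 * Real.exp (-(γ ^ 2 / 4 * (p i * n))) ≤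
      r * (2 * Real.exp (-(γ ^ 2 / 4 * √n))) := by
    have h := Finset.sum_le_card_nsmul Finset.univ
      (fun i => 2 * Real.exp (-(γ ^ 2 / 4 * (p i * n)))) (2 * Real.exp (-(γ ^ 2 / 4 * √n)))
      fun i _ => by
        have := hpn i
        gcongr
    simpa using h
  have hι' : (Fintype.card ι : ℝ) ≤ 4 * n ^ 2 := by exact_mod_cast hι
  have hfin : Fintype.card ι * ∑ i, 2 * Real.exp (-(γ ^ 2 / 4 * (p i * n))) ≤
      (4 * n ^ 2) * (n * (2 * Real.exp (-(γ ^ 2 / 4 * √n)))) := by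
    refine mul_le_mul hι' (hsum'.trans ?_) (Finset.sum_nonneg fun i _ => by positivity)
      (by positivity)
    gcongr
  have := hn₀ n ((le_max_left _ _).trans hn)
  linarith

end RandomPartition

section Partition

lemma ncard_sym2_le_sum {V : Type*} [Fintype V] (A : Set V) (P : V → V → Prop) {t : ℝ}
    (h : ∀ u ∈ A, (({v | v ∈ A ∧ P u v} : Set V).ncard : ℝ) ≤ t) :
    (({e : Sym2 V | ∃ u v, e = s(u, v) ∧ u ≠ v ∧ u ∈ A ∧ v ∈ A ∧ P u v}).ncard : ℝ) ≤
      A.ncard * t := by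
  classical
  have hsub : {e : Sym2 V | ∃ u v, e = s(u, v) ∧ u ≠ v ∧ u ∈ A ∧ v ∈ A ∧ P u v} ⊆
      (fun q : V × V => s(q.1, q.2)) '' {q | q.1 ∈ A ∧ q.2 ∈ A ∧ P q.1 q.2} := by
    rintro e ⟨u, v, rfl, -, hu, hv, huv⟩
    exact ⟨(u, v), ⟨hu, hv, huv⟩, rfl⟩
  have hle := (Set.ncard_le_ncard hsub (Set.toFinite _)).trans (Set.ncard_image_le (Set.toFinite _))
  refine (Nat.cast_le.2 hle).trans ?_
  rw [ncard_setOf_eq_sum, Fintype.sum_prod_type,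
    show (A.ncard : ℝ) = ∑ u, if u ∈ A then (1 : ℝ) else 0 from ncard_setOf_eq_sum (· ∈ A),
    Finset.sum_mul]
  refine Finset.sum_le_sum fun u _ => ?_
  by_cases hu : u ∈ A
  · have := h u hu
    rw [ncard_setOf_eq_sum] at this
    simpa [hu] using this
  · simp [hu]

lemma quasirandomOn_of_codegIn {V : Type*} [Fintype V] (G : SimpleGraph V) (A : Set V)
    {d κ : ℝ}
    (hdeg : ∀ u ∈ A, |(degIn G u A : ℝ) - d * A.ncard| ≤ κ * A.ncard)
    (hcod : ∀ u ∈ A, (({v | v ∈ A ∧ ¬ |(codegIn G u v A : ℝ) - d ^ 2 * A.ncard| ≤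
      κ * A.ncard} : Set V).ncard : ℝ) ≤ κ * A.ncard) :
    QuasirandomOn G A κ d := by
  refine ⟨hdeg, (ncard_sym2_le_sum A
    (fun u v => ¬ |(codegIn G u v A : ℝ) - d ^ 2 * A.ncard| ≤ κ * A.ncard) hcod).trans_eq ?_⟩
  ring

lemma QuasirandomOn.mono {V : Type*} {G : SimpleGraph V} {A : Set V} [Finite V] {d κ ζ : ℝ}
    (h : QuasirandomOn G A κ d) (hκ : κ ≤ ζ) : QuasirandomOn G A ζ d := by
  refine ⟨fun v hv => (h.1 v hv).trans (by gcongr), ?_⟩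
  refine le_trans (Nat.cast_le.2 (Set.ncard_le_ncard ?_ (Set.toFinite _)))
    (h.2.trans (by gcongr))
  rintro e ⟨u, v, rfl, huv, hu, hv, hc⟩
  exact ⟨u, v, rfl, huv, hu, hv, fun hc' => hc (hc'.trans (by gcongr))⟩

/-- If `x` is close to `q * s` with `s` close to `e * n`, then `x` is close to `e * w` for every
`w` close to `q * n`. -/
lemma abs_sub_mul_le_of_proportional {x s w q n e α : ℝ} (hqn : 0 ≤ q * n) (hq : 0 ≤ q)
    (he0 : 0 ≤ e) (he1 : e ≤ 1) (hα0 : 0 ≤ α) (hα : α ≤ 1 / 2)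
    (hx : |x - q * s| ≤ α * (q * n)) (hs : |s - e * n| ≤ α * n)
    (hw : |w - q * n| ≤ α * (q * n)) :
    |x - e * w| ≤ 6 * α * w := by
  have h1 : |q * (s - e * n)| ≤ α * (q * n) := by
    rw [abs_mul, abs_of_nonneg hq]
    calc _ ≤ q * (α * n) := by gcongr
      _ = _ := by ring
  have h2 : |e * (w - q * n)| ≤ α * (q * n) := by
    rw [abs_mul, abs_of_nonneg he0]
    calc _ ≤ 1 * (α * (q * n)) := by gcongr
      _ = _ := by ring
  have h3 : q * n ≤ 2 * w := by
    have h := (abs_le.1 hw).1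
    have : α * (q * n) ≤ 1 / 2 * (q * n) := by gcongr
    linarith
  have h4 : α * (q * n) ≤ α * (2 * w) := by gcongr
  rw [abs_le] at *
  constructor <;> nlinarith

lemma le_mul_of_proportional {x s w q n α : ℝ} (hqn : 0 ≤ q * n) (hq : 0 ≤ q)
    (hα0 : 0 ≤ α) (hα : α ≤ 1 / 2)
    (hx : |x - q * s| ≤ α * (q * n)) (hs0 : 0 ≤ s) (hs : s ≤ α * n)
    (hw : |w - q * n| ≤ α * (q * n)) :
    x ≤ 6 * α * w := by
  have h := abs_sub_mul_le_of_proportional (e := 0) hqn hq le_rfl zero_le_one hα0 hα hx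
    (by rwa [zero_mul, sub_zero, abs_of_nonneg hs0]) hw
  rw [zero_mul, sub_zero] at h
  exact (abs_le.1 h).2

/-- The vertices whose codegree with `u` is not `(d ^ 2 ± α) * n`. -/
def atypicalSet {n : ℕ} (G : SimpleGraph (Fin n)) (d α : ℝ) (u : Fin n) : Set (Fin n) :=
  {v | ¬ |(codegIn G u v Set.univ : ℝ) - d ^ 2 * n| ≤ α * n}

/-- The sets that a good partition has to split proportionally: the whole vertex set, the
neighbourhoods, the atypical sets, the common neighbourhoods and the monochromatic ones. -/
def controlledSet {n m : ℕ} (G : SimpleGraph (Fin n)) (φ : Sym2 (Fin n) → Fin m) (d α : ℝ) :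
    (Unit ⊕ Fin n) ⊕ (Fin n ⊕ (Fin n × Fin n ⊕ Fin n × Fin n)) → Set (Fin n)
  | .inl (.inl _) => Set.univ
  | .inl (.inr u) => G.neighborSet u
  | .inr (.inl u) => atypicalSet G d α u
  | .inr (.inr (.inl q)) => G.neighborSet q.1 ∩ G.neighborSet q.2
  | .inr (.inr (.inr q)) => monoSet G φ q.1 q.2

end Partition

/-- Lemma 2.14: passing from a quasirandom graph to a subgraph all of whose edges
behave well, together with a random-partition statement. -/
theorem stmt_13 :
    ∀ d δ Cb : ℝ, 0 < d → d ≤ 1 → 0 < δ → 1 ≤ Cb →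
    ∃ ζ₀ : ℝ, 0 < ζ₀ ∧ ∀ ζ : ℝ, 0 < ζ → ζ ≤ ζ₀ →
    ∃ η₀ : ℝ, 0 < η₀ ∧ ∀ η : ℝ, 0 < η → η ≤ η₀ →
    ∃ n₀ : ℕ, ∀ n : ℕ, n₀ ≤ n →
    ∀ (G' : SimpleGraph (Fin n)) (m : ℕ) (φ : Sym2 (Fin n) → Fin m),
      Quasirandom G' η d → GBounded G' φ (Cb * n) → LBounded G' φ (η * n) →
      ∃ G : SimpleGraph (Fin n), G ≤ G' ∧ Quasirandom G ζ d ∧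
        (∀ u v : Fin n, G.Adj u v →
          |(codegIn G u v Set.univ : ℝ) - d ^ 2 * n| ≤ ζ * n ∧
          (monoCodeg G φ u v : ℝ) ≤ ζ * n) ∧
        (∀ (r : ℕ) (p : Fin r → ℝ),
          (∀ i, (n : ℝ) ^ (-(1 : ℝ)/2) ≤ p i) → (∑ i, p i) ≤ 1 →
          (0.9 : ℝ) ≤ ∑ σ : Fin n → Option (Fin r),
            Set.indicator
              {σ' : Fin n → Option (Fin r) |
                -- (A1)
                (∀ i, |((part σ' i).ncard : ℝ) - p i * n| ≤ ζ * (p i * n)) ∧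
                -- (A2)
                (∀ i j, i ≠ j →
                  SuperregularPair G (part σ' i) (part σ' j) ζ d) ∧
                -- (A3)
                (∀ v w : Fin n, G.Adj v w → ∀ i,
                  ((monoSet G φ v w ∩ part σ' i).ncard : ℝ)
                      ≤ ζ * ((part σ' i).ncard : ℝ) ∧
                  |(codegIn G v w (part σ' i) : ℝ) - d ^ 2 * ((part σ' i).ncard : ℝ)|
                      ≤ ζ * ((part σ' i).ncard : ℝ)) ∧
                -- (A4)
                (∀ i, QuasirandomOn G (part σ' i) ζ d)}
              (partWeight p) σ) := by
  intro d _ _ hd0 hd1 _ _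
  refine ⟨1, one_pos, fun ζ hζ hζ1 => ?_⟩
  set α := ζ ^ 4 / 24 with hα
  have hα0 : 0 < α := by positivity
  have hζ4 : ζ ^ 4 ≤ ζ := pow_le_of_le_one hζ.le hζ1 (by norm_num)
  have hα2 : α ≤ 1 / 2 := by rw [hα]; linarith
  have h6α : 6 * α ≤ ζ := by rw [hα]; linarith
  have hαζ : α ≤ ζ := by linarith
  obtain ⟨η₀, hη₀, hclean⟩ := exists_typical_subgraph hd0.le hd1 hα0 (by linarith)
  obtain ⟨n₁, hpart⟩ := exists_forall_le_sum_indicator_partWeight hα0 (by linarith)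
  refine ⟨η₀, hη₀, fun η hη hηη₀ => ?_⟩
  obtain ⟨n₂, hclean⟩ := hclean η hη hηη₀
  refine ⟨max (max n₁ n₂) 2, fun n hn G' m φ hG' _ hφ => ?_⟩
  have hn₁ : n₁ ≤ n := (le_max_left _ _).trans ((le_max_left _ _).trans hn)
  have hn₂ : n₂ ≤ n := (le_max_right _ _).trans ((le_max_left _ _).trans hn)
  have hn2 : 2 ≤ n := (le_max_right _ _).trans hn
  have hn0 : (0 : ℝ) < n := by exact_mod_cast two_pos.trans_le hn2
  obtain ⟨G, hGG', hdeg, hcod, hedge⟩ := hclean n hn₂ G' m φ hG' hφ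
  refine ⟨G, hGG', ?_, fun u v huv => ?_, fun r p hp hsum => ?_⟩
  · refine QuasirandomOn.mono (quasirandomOn_of_codegIn G Set.univ (κ := α) ?_ ?_) hαζ
    · intro u _
      simpa [Set.ncard_univ] using hdeg u
    · intro u _
      simpa only [Set.ncard_univ, Nat.card_eq_fintype_card, Fintype.card_fin, Set.mem_univ,
        true_and] using hcod u
  · obtain ⟨h1, h2⟩ := hedge u v huv
    exact ⟨h1.trans (by gcongr), h2.trans (by gcongr)⟩
  refine hpart n hn₁ _ (controlledSet G φ d α) ?_ r p hp hsum _ fun σ hσ => ?_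
  · simp only [Fintype.card_sum, Fintype.card_prod, Fintype.card_fin, Fintype.card_unit]
    nlinarith
  have hp0 : ∀ i, 0 < p i := fun i => (Real.rpow_pos_of_pos hn0 _).trans_le (hp i)
  have hpn : ∀ i, 0 < p i * n := fun i => mul_pos (hp0 i) hn0
  have hsize : ∀ i, |((part σ i).ncard : ℝ) - p i * n| ≤ α * (p i * n) := by
    intro i
    simpa [controlledSet, Set.ncard_univ] using hσ (.inl (.inl ())) i
  have hpos : ∀ i, 0 < (part σ i).ncard := by
    intro i
    have h1 := (abs_le.1 (hsize i)).1
    have h2 : α * (p i * n) ≤ 1 / 2 * (p i * n) := mul_le_mul_of_nonneg_right hα2 (hpn i).le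
    have h3 : (0 : ℝ) < (part σ i).ncard := by linarith [hpn i]
    exact_mod_cast h3
  have hdegP : ∀ u i, |(degIn G u (part σ i) : ℝ) - d * (part σ i).ncard| ≤
      6 * α * (part σ i).ncard := by
    intro u i
    have h1 := hσ (.inl (.inr u)) i
    have h2 := hdeg u
    simp only [degIn, Set.inter_univ] at h2
    exact abs_sub_mul_le_of_proportional (hpn i).le (hp0 i).le hd0.le hd1 hα0.le hα2 h1 h2
      (hsize i)
  have hcodP : ∀ u v i, |(codegIn G u v Set.univ : ℝ) - d ^ 2 * n| ≤ α * n →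
      |(codegIn G u v (part σ i) : ℝ) - d ^ 2 * (part σ i).ncard| ≤
        6 * α * (part σ i).ncard := by
    intro u v i h2
    have h1 := hσ (.inr (.inr (.inl (u, v)))) i
    simp only [codegIn, Set.inter_univ] at h2
    exact abs_sub_mul_le_of_proportional (hpn i).le (hp0 i).le (sq_nonneg d)
      (pow_le_one₀ hd0.le hd1) hα0.le hα2 h1 h2 (hsize i)
  have hatyp : ∀ u i j, (({v | v ∈ part σ i ∧ ¬ |(codegIn G u v (part σ j) : ℝ) -
      d ^ 2 * (part σ j).ncard| ≤ 6 * α * (part σ j).ncard} : Set (Fin n)).ncard : ℝ) ≤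
      6 * α * (part σ i).ncard := by
    intro u i j
    have h1 := le_mul_of_proportional (hpn i).le (hp0 i).le hα0.le hα2 (hσ (.inr (.inl u)) i)
      (Nat.cast_nonneg _) (hcod u) (hsize i)
    refine le_trans (Nat.cast_le.2 (Set.ncard_le_ncard ?_ (Set.toFinite _))) h1
    exact fun v hv => ⟨fun h => hv.2 (hcodP u v j h), hv.1⟩
  have hloose : ∀ i, 6 * α * ((part σ i).ncard : ℝ) ≤ ζ * (part σ i).ncard := fun i => by gcongr
  refine ⟨fun i => (hsize i).trans ?_, fun i j hij => ⟨?_, fun u _ => (hdegP u j).trans (hloose j),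
    fun u _ => (hdegP u i).trans (hloose i)⟩, fun v w hvw i => ⟨?_, ?_⟩, fun i => ?_⟩
  · exact mul_le_mul_of_nonneg_right hαζ (hpn i).le
  · refine regularPair_of_codegIn G _ _ ?_ hd0.le hd1 (by positivity) hζ hζ1
      (by rw [hα]; linarith) (hpos i) (hpos j) (fun u _ => hdegP u j) fun u _ => hatyp u i j
    refine Set.disjoint_left.2 fun v hvi hvj => hij ?_
    exact Option.some.inj (Eq.trans (Eq.symm hvi) hvj)
  · exact (le_mul_of_proportional (hpn i).le (hp0 i).le hα0.le hα2
      (hσ (.inr (.inr (.inr (v, w)))) i) (Nat.cast_nonneg _) (hedge v w hvw).2 (hsize i)).trans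
      (hloose i)
  · exact (hcodP v w i (hedge v w hvw).1).trans (hloose i)
  · exact QuasirandomOn.mono
      (quasirandomOn_of_codegIn G _ (fun u _ => hdegP u i) fun u _ => hatyp u i i) h6α
end

section
/- For every C ≥ 1 there exists ζ₀ > 0 such that for every 0 < ζ ≤ ζ₀ there exists n₀ ∈ ℕ with the following property for all n ≥ n₀ and all r ∈ ℕ. Suppose ℓ ≥ n/(log n)³, G is an n-vertex graph with at most Cn edges and maximum degree Δ(G) ≤ ℓ, and each vertex of G is independently assigned to the part V_i with probability p_i for i ∈ [r], where p_i ≥ (log n)^{−2} for each i and Σ_{i∈[r]} p_i ≤ 1; let p := min_{i∈[r]} p_i. Then with probability at least 1 − 2r²·e^{−ζ³pn/ℓ}, for all i ≠ j ∈ [r]: e(G[V_i,V_j]) = 2p_ip_j·e(G) ± ζp_ip_j·n and e(G[V_i]) = p_i²·e(G) ± ζp_i²·n. -/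
open Paper

/-- The weight of a set of outcomes under a finite weight function. -/
noncomputable def weightOf {ι : Type*} [Fintype ι] (w : ι → ℝ) (S : Set ι) : ℝ :=
  ∑ x, S.indicator w x

section weightOf

variable {ι κ : Type*} [Fintype ι] {w : ι → ℝ}

lemma weightOf_mono (hw : ∀ x, 0 ≤ w x) {S T : Set ι} (h : S ⊆ T) :
    weightOf w S ≤ weightOf w T :=
  Finset.sum_le_sum fun x _ => Set.indicator_le_indicator_of_subset h hw x

lemma weightOf_union_le (hw : ∀ x, 0 ≤ w x) (S T : Set ι) :
    weightOf w (S ∪ T) ≤ weightOf w S + weightOf w T := by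
  classical
  unfold weightOf
  rw [← Finset.sum_add_distrib]
  refine Finset.sum_le_sum fun x _ => ?_
  have := hw x
  by_cases hS : x ∈ S <;> by_cases hT : x ∈ T <;> simp [hS, hT, this]

lemma weightOf_iUnion_le [Fintype κ] (hw : ∀ x, 0 ≤ w x) (S : κ → Set ι) :
    weightOf w (⋃ k, S k) ≤ ∑ k, weightOf w (S k) := by
  classical
  unfold weightOf
  rw [Finset.sum_comm]
  refine Finset.sum_le_sum fun x _ => ?_
  have hnn : ∀ k ∈ Finset.univ, 0 ≤ (S k).indicator w x := fun k _ =>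
    Set.indicator_nonneg (fun y _ => hw y) x
  by_cases h : x ∈ ⋃ k, S k
  · obtain ⟨k, hk⟩ := Set.mem_iUnion.1 h
    rw [Set.indicator_of_mem h, ← Set.indicator_of_mem hk w]
    exact Finset.single_le_sum hnn (Finset.mem_univ k)
  · rw [Set.indicator_of_notMem h]
    exact Finset.sum_nonneg hnn

lemma weightOf_compl (S : Set ι) : weightOf w S = ∑ x, w x - weightOf w Sᶜ := by
  classical
  unfold weightOf
  rw [← Finset.sum_sub_distrib]
  refine Finset.sum_congr rfl fun x _ => ?_
  by_cases hS : x ∈ S <;> simp [hS]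

lemma weightOf_le_exp_neg (hw : ∀ x, 0 ≤ w x) {F : ι → ℝ}
    (hF : ∑ x, w x * Real.exp (F x) ≤ 1) (T : ℝ) :
    weightOf w {x | T ≤ F x} ≤ Real.exp (-T) := by
  classical
  have key : weightOf w {x | T ≤ F x} ≤ ∑ x, Real.exp (-T) * (w x * Real.exp (F x)) := by
    refine Finset.sum_le_sum fun x _ => ?_
    by_cases h : T ≤ F x
    · rw [Set.indicator_of_mem (by exact h)]
      have h1 : 1 ≤ Real.exp (-T) * Real.exp (F x) := by
        rw [← Real.exp_add]; exact Real.one_le_exp (by linarith)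
      nlinarith [hw x]
    · rw [Set.indicator_of_notMem (by exact h)]
      have := hw x
      positivity
  rw [← Finset.mul_sum] at key
  nlinarith [Real.exp_pos (-T)]

end weightOf

section product

variable {α : Type*} [Fintype α] {μ : α → ℝ}

lemma sum_prod_mul_le_one (hμ : ∀ a, 0 ≤ μ a) (h1 : ∑ a, μ a = 1) :
    ∀ (n : ℕ) (H : Fin n → (Fin n → α) → ℝ), (∀ v σ, 0 ≤ H v σ) →
      (∀ v σ τ, (∀ u ≤ v, σ u = τ u) → H v σ = H v τ) →
      (∀ v σ, ∑ a, μ a * H v (Function.update σ v a) ≤ 1) →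
      ∑ σ : Fin n → α, ∏ v, (μ (σ v) * H v σ) ≤ 1 := by
  intro n
  induction n with
  | zero => intro H _ _ _; simp
  | succ n ih =>
    intro H h0 hdep hsum
    have hne : Nonempty α := by
      by_contra hcon
      rw [not_nonempty_iff] at hcon
      simp at h1
    obtain ⟨a₀⟩ := hne
    rw [← (Fin.consEquiv fun _ : Fin (n + 1) => α).sum_comp, Fintype.sum_prod_type]
    refine le_trans (Finset.sum_le_sum fun a _ => ?_) (hsum 0 fun _ => a₀)
    have hH0 : ∀ τ : Fin n → α, H 0 (Fin.cons a τ : Fin (n + 1) → α) =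
        H 0 (Function.update (fun _ => a₀) 0 a) := by
      intro τ
      refine hdep _ _ _ fun u hu => ?_
      obtain rfl : u = 0 := Fin.le_zero_iff.1 hu
      simp
    have hterm : ∀ τ : Fin n → α,
        ∏ v, (μ ((Fin.consEquiv fun _ : Fin (n + 1) => α) (a, τ) v) *
            H v ((Fin.consEquiv fun _ : Fin (n + 1) => α) (a, τ))) =
          μ a * H 0 (Function.update (fun _ => a₀) 0 a) *
            ∏ v, (μ (τ v) * H v.succ (Fin.cons a τ : Fin (n + 1) → α)) := by
      intro τ
      rw [Fin.prod_univ_succ]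
      simp [Fin.consEquiv, hH0]
    simp only [hterm, ← Finset.mul_sum]
    refine mul_le_of_le_one_right (mul_nonneg (hμ a) (h0 _ _)) ?_
    refine ih (fun v τ => H v.succ (Fin.cons a τ : Fin (n + 1) → α)) (fun _ _ => h0 _ _) ?_ ?_
    · intro v σ τ h
      refine hdep _ _ _ fun u hu => ?_
      induction u using Fin.cases with
      | zero => simp
      | succ u => simpa using h u (Fin.succ_le_succ_iff.1 hu)
    · intro v σ
      simpa [Fin.cons_update] using hsum v.succ (Fin.cons a σ : Fin (n + 1) → α)

variable [DecidableEq α]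

lemma sum_mul_exp_centered_le_one (hμ : ∀ a, 0 ≤ μ a) (h1 : ∑ a, μ a = 1) (b : α) {s : ℝ}
    (hs : |s| ≤ 1) :
    ∑ a, μ a * Real.exp (s * ((if a = b then 1 else 0) - μ b) - μ b * s ^ 2) ≤ 1 := by
  have hsplit : ∀ a, μ a * Real.exp (s * ((if a = b then 1 else 0) - μ b) - μ b * s ^ 2) =
      Real.exp (-(μ b * s + μ b * s ^ 2)) *
        (μ a + (if a = b then μ b * (Real.exp s - 1) else 0)) := by
    intro a
    split_ifs with h
    · subst h
      rw [show s * (1 - μ a) - μ a * s ^ 2 = -(μ a * s + μ a * s ^ 2) + s by ring, Real.exp_add]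
      ring
    · rw [show s * (0 - μ b) - μ b * s ^ 2 = -(μ b * s + μ b * s ^ 2) by ring]
      ring
  simp only [hsplit, ← Finset.mul_sum, Finset.sum_add_distrib, h1, Finset.sum_ite_eq',
    Finset.mem_univ, if_true]
  have h2 : Real.exp s - 1 ≤ s + s ^ 2 := by
    have := (abs_le.1 (Real.abs_exp_sub_one_sub_id_le hs)).2
    linarith
  have h3 : 1 + μ b * (Real.exp s - 1) ≤ Real.exp (μ b * s + μ b * s ^ 2) := by
    have := Real.add_one_le_exp (μ b * s + μ b * s ^ 2)
    nlinarith [hμ b]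
  calc _ ≤ Real.exp (-(μ b * s + μ b * s ^ 2)) * Real.exp (μ b * s + μ b * s ^ 2) := by gcongr
    _ = 1 := by rw [← Real.exp_add]; simp

/-- Exponential tail bound for sums of predictable multiples of centred indicators. -/
lemma weightOf_centered_sum_le (hμ : ∀ a, 0 ≤ μ a) (h1 : ∑ a, μ a = 1) (b : α) {n : ℕ}
    (W : Fin n → (Fin n → α) → ℝ) (hW : ∀ v σ, |W v σ| ≤ 1)
    (hdep : ∀ v σ τ, (∀ u < v, σ u = τ u) → W v σ = W v τ) (T : ℝ) :
    weightOf (fun σ : Fin n → α => ∏ v, μ (σ v))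
      {σ | T ≤ ∑ v, (W v σ * ((if σ v = b then 1 else 0) - μ b) - μ b * W v σ ^ 2)} ≤
      Real.exp (-T) := by
  refine weightOf_le_exp_neg (fun σ => Finset.prod_nonneg fun v _ => hμ _) ?_ T
  simp only [Real.exp_sum, ← Finset.prod_mul_distrib]
  refine sum_prod_mul_le_one hμ h1 n (fun v σ => Real.exp
    (W v σ * ((if σ v = b then 1 else 0) - μ b) - μ b * W v σ ^ 2))
    (fun _ _ => (Real.exp_pos _).le) ?_ ?_
  · intro v σ τ h
    simp only [hdep v σ τ fun u hu => h u hu.le, h v le_rfl]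
  · intro v σ
    have h2 : ∀ a, W v (Function.update σ v a) = W v σ := fun a =>
      hdep _ _ _ fun u hu => Function.update_of_ne hu.ne _ _
    simp only [h2, Function.update_self]
    exact sum_mul_exp_centered_le_one hμ h1 b (hW v σ)

end product

section deviation

variable {α : Type*} [Fintype α] [DecidableEq α] {μ : α → ℝ}

lemma weightOf_abs_centered_sum_le (hμ : ∀ a, 0 ≤ μ a) (h1 : ∑ a, μ a = 1) (b : α) {n : ℕ}
    (W : Fin n → (Fin n → α) → ℝ) {c M : ℝ} (hc : 0 < c) (hcM : c * M ≤ 1)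
    (hW0 : ∀ v σ, 0 ≤ W v σ) (hWM : ∀ v σ, W v σ ≤ M)
    (hdep : ∀ v σ τ, (∀ u < v, σ u = τ u) → W v σ = W v τ) (t K : ℝ) :
    weightOf (fun σ : Fin n → α => ∏ v, μ (σ v))
      {σ | ¬ |∑ v, W v σ * ((if σ v = b then 1 else 0) - μ b)| ≤ t ∧ ∑ v, W v σ ^ 2 ≤ K} ≤
      2 * Real.exp (-(c * t - μ b * c ^ 2 * K)) := by
  have habs : ∀ e : ℝ, |e| = 1 → ∀ v σ, |e * (c * W v σ)| ≤ 1 := fun e he v σ => by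
    rw [abs_mul, he, one_mul, abs_of_nonneg (mul_nonneg hc.le (hW0 v σ))]
    exact (mul_le_mul_of_nonneg_left (hWM v σ) hc.le).trans hcM
  have tail : ∀ e : ℝ, |e| = 1 → _ := fun e he => weightOf_centered_sum_le hμ h1 b
    (fun v σ => e * (c * W v σ)) (habs e he) (fun v σ τ h => by simp only [hdep v σ τ h])
    (c * t - μ b * c ^ 2 * K)
  have hw : ∀ σ : Fin n → α, 0 ≤ ∏ v, μ (σ v) := fun σ => Finset.prod_nonneg fun v _ => hμ _
  refine (weightOf_mono hw ?_).trans ((weightOf_union_le hw _ _).trans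
    ((add_le_add (tail 1 (by simp)) (tail (-1) (by simp))).trans_eq (by ring)))
  rintro σ ⟨hdev, hK⟩
  have hsum : ∀ e : ℝ, e ^ 2 = 1 →
      ∑ v, (e * (c * W v σ) * ((if σ v = b then 1 else 0) - μ b) -
        μ b * (e * (c * W v σ)) ^ 2) =
      e * (c * ∑ v, W v σ * ((if σ v = b then 1 else 0) - μ b)) -
        μ b * c ^ 2 * ∑ v, W v σ ^ 2 := by
    intro e he
    rw [Finset.sum_sub_distrib]
    simp only [Finset.mul_sum]
    refine congrArg₂ _ (Finset.sum_congr rfl fun v _ => by ring)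
      (Finset.sum_congr rfl fun v _ => ?_)
    linear_combination (μ b * c ^ 2 * W v σ ^ 2) * he
  have hK' : μ b * c ^ 2 * ∑ v, W v σ ^ 2 ≤ μ b * c ^ 2 * K :=
    mul_le_mul_of_nonneg_left hK (mul_nonneg (hμ b) (sq_nonneg c))
  simp only [Set.mem_union, Set.mem_ofPred_eq, hsum 1 (by norm_num), hsum (-1) (by norm_num)]
  rw [not_le, lt_abs] at hdev
  rcases hdev with h | h
  · left; nlinarith
  · right; nlinarith

lemma weightOf_edge_deviation_le (hμ : ∀ a, 0 ≤ μ a) (h1 : ∑ a, μ a = 1) (a b : α)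
    (ha : 0 < μ a) (hb : 0 < μ b) {n : ℕ} (hn : 0 < n) (A : Fin n → Fin n → ℝ)
    (hA0 : ∀ u v, 0 ≤ A u v) (hA1 : ∀ u v, A u v ≤ 1) (hlt : ∀ u v, ¬ u < v → A u v = 0)
    {l C ζ : ℝ} (hl : 0 < l) (hC : 1 ≤ C) (hζ : 0 < ζ) (hζ1 : ζ ≤ 1)
    (hcol : ∀ v, ∑ u, A u v ≤ l) (hrow : ∀ u, ∑ v, A u v ≤ l)
    (htot : ∑ u, ∑ v, A u v ≤ C * n) :
    weightOf (fun σ : Fin n → α => ∏ v, μ (σ v))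
      {σ | ¬ |∑ u, ∑ v, A u v * (if σ u = a ∧ σ v = b then 1 else 0) -
          μ a * μ b * ∑ u, ∑ v, A u v| ≤ ζ / 2 * (μ a * μ b * n)} ≤
      n * (2 * Real.exp (-(l * μ a))) + 2 * Real.exp (-(ζ ^ 2 * μ a * n / (64 * C * l))) +
        2 * Real.exp (-(ζ ^ 2 * μ b * n / (384 * C * l))) := by
  have hn' : (0 : ℝ) < n := by exact_mod_cast hn
  have hC0 : 0 < C := by linarith
  have hw : ∀ σ : Fin n → α, 0 ≤ ∏ v, μ (σ v) := fun σ => Finset.prod_nonneg fun v _ => hμ _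
  set q := μ a with hq
  set s := μ b with hs
  let D : Fin n → (Fin n → α) → ℝ := fun v σ => ∑ u, A u v * (if σ u = a then 1 else 0)
  have hD0 : ∀ v σ, 0 ≤ D v σ := fun v σ => Finset.sum_nonneg fun u _ =>
    mul_nonneg (hA0 u v) (by split_ifs <;> norm_num)
  have hDdep : ∀ v σ τ, (∀ u < v, σ u = τ u) → D v σ = D v τ := by
    intro v σ τ h
    refine Finset.sum_congr rfl fun u _ => ?_
    by_cases huv : u < v
    · rw [h u huv]
    · simp [hlt u v huv]
  have tailDeg : ∀ v, _ := fun v => weightOf_abs_centered_sum_le hμ h1 a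
    (fun u (_ : Fin n → α) => A u v) (c := 1) (M := 1) one_pos (by norm_num)
    (fun _ _ => hA0 _ _) (fun _ _ => hA1 _ _) (fun _ _ _ _ => rfl) (2 * l * q) l
  have tailLin := weightOf_abs_centered_sum_le hμ h1 a
    (fun u (_ : Fin n → α) => ∑ v, A u v) (c := ζ / (8 * C * l)) (M := l) (by positivity)
    (by rw [div_mul_eq_mul_div, div_le_one (by positivity)]; nlinarith)
    (fun _ _ => Finset.sum_nonneg fun _ _ => hA0 _ _) (fun _ _ => hrow _) (fun _ _ _ _ => rfl)
    (ζ / 4 * (q * n)) (l * (C * n))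
  have tailQuad := weightOf_abs_centered_sum_le hμ h1 b
    (fun v σ => min (D v σ) (3 * l * q)) (c := ζ / (48 * C * l * q)) (M := 3 * l * q)
    (by positivity)
    (by
      rw [div_mul_eq_mul_div, div_le_one (by positivity)]
      have h2 : 0 < l * q := by positivity
      have h3 : ζ ≤ C := hζ1.trans hC
      nlinarith)
    (fun v σ => le_min (hD0 v σ) (by positivity)) (fun _ _ => min_le_right _ _)
    (fun v σ τ h => by simp only [hDdep v σ τ h])
    (ζ / 4 * (q * s * n)) (6 * C * l * q ^ 2 * n)
  rw [← hq, show ζ / (8 * C * l) * (ζ / 4 * (q * n)) -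
    q * (ζ / (8 * C * l)) ^ 2 * (l * (C * n)) = ζ ^ 2 * q * n / (64 * C * l) by
      field_simp; ring] at tailLin
  rw [← hs, show ζ / (48 * C * l * q) * (ζ / 4 * (q * s * n)) -
    s * (ζ / (48 * C * l * q)) ^ 2 * (6 * C * l * q ^ 2 * n) =
      ζ ^ 2 * s * n / (384 * C * l) by field_simp; ring] at tailQuad
  simp only [← hq, show 1 * (2 * l * q) - q * 1 ^ 2 * l = l * q by ring] at tailDeg
  have tailDegs := (weightOf_iUnion_le hw _).trans (Finset.sum_le_sum fun v _ => tailDeg v)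
  simp only [Finset.sum_const, Finset.card_univ, Fintype.card_fin, nsmul_eq_mul] at tailDegs
  refine (weightOf_mono hw ?_).trans ((weightOf_union_le hw _ _).trans (add_le_add
    ((weightOf_union_le hw _ _).trans (add_le_add tailDegs tailLin)) tailQuad))
  intro σ hσ
  by_contra hcon
  simp only [Set.mem_union, Set.mem_iUnion, not_or, not_exists, Set.mem_ofPred_eq, not_and',
    not_not] at hcon
  obtain ⟨⟨hdeg, hlin⟩, hquad⟩ := hcon
  refine hσ ?_
  have hD3 : ∀ v, D v σ ≤ 3 * l * q := by
    intro v
    have h2 := (abs_le.1 (hdeg v ((Finset.sum_le_sum fun u _ => ?_).trans (hcol v)))).2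
    · simp only [mul_sub, Finset.sum_sub_distrib, ← Finset.sum_mul] at h2
      change D v σ - _ ≤ _ at h2
      nlinarith [hcol v]
    · nlinarith [hA0 u v, hA1 u v]
  have hmin : ∀ v, min (D v σ) (3 * l * q) = D v σ := fun v => min_eq_left (hD3 v)
  simp only [hmin] at hquad
  replace hlin := hlin (by
    calc ∑ u, (∑ v, A u v) ^ 2 ≤ ∑ u, l * ∑ v, A u v := Finset.sum_le_sum fun u _ => by
            have := Finset.sum_nonneg fun v (_ : v ∈ Finset.univ) => hA0 u v
            nlinarith [hrow u]
      _ = l * ∑ u, ∑ v, A u v := by rw [Finset.mul_sum]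
      _ ≤ _ := by gcongr)
  have hDsum : ∑ v, D v σ = ∑ u, (∑ v, A u v) * (if σ u = a then 1 else 0) := by
    simp only [D, Finset.sum_mul]
    rw [Finset.sum_comm]
  simp only [mul_sub, Finset.sum_sub_distrib, ← Finset.sum_mul] at hlin
  rw [← hDsum] at hlin
  have hDtot : ∑ v, D v σ ≤ 2 * C * q * n := by
    have h2 := (abs_le.1 hlin).2
    have h3 : 0 < q * n := by positivity
    nlinarith
  replace hquad := hquad (by
    calc ∑ v, D v σ ^ 2 ≤ ∑ v, 3 * l * q * D v σ := Finset.sum_le_sum fun v _ => by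
            nlinarith [hD0 v σ, hD3 v]
      _ = 3 * l * q * ∑ v, D v σ := by rw [Finset.mul_sum]
      _ ≤ 3 * l * q * (2 * C * q * n) := by gcongr
      _ = _ := by ring)
  simp only [mul_sub, Finset.sum_sub_distrib, ← Finset.sum_mul] at hquad
  have hcount : ∑ u, ∑ v, A u v * (if σ u = a ∧ σ v = b then 1 else 0) =
      ∑ v, D v σ * (if σ v = b then 1 else 0) := by
    simp only [D, Finset.sum_mul]
    rw [Finset.sum_comm]
    refine Finset.sum_congr rfl fun v _ => Finset.sum_congr rfl fun u _ => ?_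
    by_cases h2 : σ u = a <;> by_cases h3 : σ v = b <;> simp [h2, h3]
  rw [hcount]
  rw [abs_le] at hlin hquad ⊢
  constructor <;> nlinarith

end deviation

section counting

open Classical in
lemma ncard_edges_eq_sum {n : ℕ} (G : SimpleGraph (Fin n)) (P : Fin n → Fin n → Prop) :
    (({e | e ∈ G.edgeSet ∧ ∃ u v, e = s(u, v) ∧ P u v} : Set (Sym2 (Fin n))).ncard : ℝ) =
      ∑ u, ∑ v, (if u < v ∧ G.Adj u v then 1 else 0) * (if P u v ∨ P v u then 1 else 0) := by
  have himg : {e | e ∈ G.edgeSet ∧ ∃ u v, e = s(u, v) ∧ P u v} =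
      (fun x : Fin n × Fin n => s(x.1, x.2)) ''
        ((Finset.univ.filter fun x : Fin n × Fin n =>
          (x.1 < x.2 ∧ G.Adj x.1 x.2) ∧ (P x.1 x.2 ∨ P x.2 x.1) : Finset (Fin n × Fin n)) :
            Set (Fin n × Fin n)) := by
    ext e
    simp only [Set.mem_ofPred_eq, Set.mem_image, Finset.coe_filter, Finset.mem_univ, true_and,
      Prod.exists]
    constructor
    · rintro ⟨he, u, v, rfl, hP⟩
      rw [SimpleGraph.mem_edgeSet] at he
      rcases lt_or_gt_of_ne he.ne with h | h
      · exact ⟨u, v, ⟨⟨h, he⟩, Or.inl hP⟩, rfl⟩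
      · exact ⟨v, u, ⟨⟨h, he.symm⟩, Or.inr hP⟩, Sym2.eq_swap⟩
    · rintro ⟨u, v, ⟨⟨_, he⟩, hP | hP⟩, rfl⟩
      · exact ⟨he, u, v, rfl, hP⟩
      · exact ⟨he, v, u, Sym2.eq_swap, hP⟩
  rw [himg, Set.InjOn.ncard_image, Set.ncard_coe_finset, Finset.card_filter,
    Fintype.sum_prod_type]
  · push_cast
    refine Finset.sum_congr rfl fun u _ => Finset.sum_congr rfl fun v _ => ?_
    by_cases h1 : u < v ∧ G.Adj u v <;> by_cases h2 : P u v ∨ P v u <;> simp [h1, h2]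
  · rintro ⟨u, v⟩ hx ⟨u', v'⟩ hy h
    simp only [Finset.coe_filter, Finset.mem_univ, true_and, Set.mem_ofPred_eq] at hx hy
    rcases Sym2.eq_iff.1 h with ⟨h1, h2⟩ | ⟨h1, h2⟩
    · simp_all
    · simp only at h1 h2
      subst h1 h2
      exact absurd hx.1.1 hy.1.1.not_gt


open Classical in
lemma sum_ite_adj_le_ncard {n : ℕ} (G : SimpleGraph (Fin n)) (v : Fin n) (Q : Fin n → Prop) :
    ∑ u, (if Q u ∧ G.Adj v u then (1 : ℝ) else 0) ≤ (G.neighborSet v).ncard := by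
  rw [← Finset.sum_filter_add_sum_filter_not Finset.univ (fun u => G.Adj v u)]
  have h : (G.neighborSet v) = ((Finset.univ.filter fun u => G.Adj v u : Finset (Fin n)) :
      Set (Fin n)) := by ext; simp
  rw [h, Set.ncard_coe_finset, Finset.card_eq_sum_ones, Finset.sum_filter (fun u => ¬ G.Adj v u)]
  push_cast
  have h2 : ∀ u, (if ¬ G.Adj v u then (if Q u ∧ G.Adj v u then (1 : ℝ) else 0) else 0) = 0 := by
    intro u
    by_cases h3 : G.Adj v u <;> simp [h3]
  simp only [h2, Finset.sum_const_zero, add_zero]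
  exact Finset.sum_le_sum fun u _ => by split_ifs <;> norm_num

end counting

lemma exists_forall_log_add_log_pow_le :
    ∃ n₀ : ℕ, ∀ n : ℕ, n₀ ≤ n → 3 ≤ n ∧
      Real.log n + Real.log n ^ 3 ≤ n / Real.log n ^ 5 := by
  have h6 := (Real.isLittleO_pow_log_id_atTop (n := 6)).bound (show (0 : ℝ) < 1 / 2 by norm_num)
  have h8 := (Real.isLittleO_pow_log_id_atTop (n := 8)).bound (show (0 : ℝ) < 1 / 2 by norm_num)
  have h := tendsto_natCast_atTop_atTop (R := ℝ) |>.eventually (h6.and h8)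
  obtain ⟨n₀, hn₀⟩ := Filter.eventually_atTop.1 (h.and (Filter.eventually_ge_atTop 3))
  refine ⟨n₀, fun n hn => ?_⟩
  obtain ⟨⟨h1, h2⟩, h3⟩ := hn₀ n hn
  refine ⟨h3, ?_⟩
  have h3' : (3 : ℝ) ≤ n := by exact_mod_cast h3
  have hlog : 0 < Real.log n := Real.log_pos (by linarith)
  simp only [id, Real.norm_eq_abs, abs_of_pos (pow_pos hlog _),
    abs_of_pos (show (0 : ℝ) < n by linarith)] at h1 h2
  rw [le_div_iff₀ (pow_pos hlog 5)]
  nlinarith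

/-- Lemma 2.15: concentration of the number of edges between and inside the parts of
a random vertex partition of a sparse graph of small maximum degree. -/
theorem stmt_14 :
    ∀ Cb : ℝ, 1 ≤ Cb →
    ∃ ζ₀ : ℝ, 0 < ζ₀ ∧ ∀ ζ : ℝ, 0 < ζ → ζ ≤ ζ₀ →
    ∃ n₀ : ℕ, ∀ n : ℕ, n₀ ≤ n → ∀ r : ℕ,
    ∀ l : ℝ, (n : ℝ) / (Real.log n) ^ 3 ≤ l →
    ∀ G : SimpleGraph (Fin n),
      ((G.edgeSet.ncard : ℝ) ≤ Cb * n) →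
      (∀ v, ((G.neighborSet v).ncard : ℝ) ≤ l) →
    ∀ p : Fin r → ℝ,
      (∀ i, ((Real.log n) ^ 2)⁻¹ ≤ p i) → (∑ i, p i) ≤ 1 →
    ∀ pm : ℝ, (∀ i, pm ≤ p i) →
      1 - 2 * (r : ℝ) ^ 2 * Real.exp (-(ζ ^ 3 * pm * n / l)) ≤
        ∑ σ : Fin n → Option (Fin r),
          Set.indicator
            {σ' : Fin n → Option (Fin r) |
              (∀ i j, i ≠ j →
                |((edgesBetween G (part σ' i) (part σ' j)).ncard : ℝ) -
                    2 * p i * p j * (G.edgeSet.ncard : ℝ)| ≤ ζ * (p i * p j * n)) ∧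
              (∀ i,
                |((edgesBetween G (part σ' i) (part σ' i)).ncard : ℝ) -
                    p i ^ 2 * (G.edgeSet.ncard : ℝ)| ≤ ζ * (p i ^ 2 * n))}
            (partWeight p) σ := by
  classical
  intro C hC
  refine ⟨1 / (1152 * C), by positivity, fun ζ hζ hζC => ?_⟩
  obtain ⟨n₀, hn₀⟩ := exists_forall_log_add_log_pow_le
  refine ⟨n₀, fun n hn r l hl G he hdeg p hp hpsum pm hpm => ?_⟩
  obtain ⟨hn3, hlogn⟩ := hn₀ n hn
  have hn' : (3 : ℝ) ≤ n := by exact_mod_cast hn3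
  have hn0 : (0 : ℝ) < n := by linarith
  have hlog : 0 < Real.log n := Real.log_pos (by linarith)
  have hl0 : 0 < l := lt_of_lt_of_le (by positivity) hl
  have hζC' : ζ * (1152 * C) ≤ 1 := (le_div_iff₀ (by positivity)).1 hζC
  have hζ1 : 1152 * ζ ≤ 1 := by nlinarith
  have hp0 : ∀ i, 0 < p i := fun i => lt_of_lt_of_le (by positivity) (hp i)
  let μ : Option (Fin r) → ℝ := fun o => o.elim (1 - ∑ i, p i) p
  have hμ : ∀ o, 0 ≤ μ o := by
    rintro (_ | i)
    · exact sub_nonneg.2 hpsum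
    · exact (hp0 i).le
  have hμ1 : ∑ o, μ o = 1 := by simp [Fintype.sum_option, μ]
  have hweight : partWeight p = fun σ : Fin n → Option (Fin r) => ∏ v, μ (σ v) := rfl
  have hw : ∀ σ : Fin n → Option (Fin r), 0 ≤ partWeight p σ := fun σ =>
    Finset.prod_nonneg fun v _ => hμ _
  have htotal : ∑ σ : Fin n → Option (Fin r), partWeight p σ = 1 := by
    rw [hweight]
    have := Fintype.sum_pow μ n
    rw [← this, hμ1, one_pow]
  let A : Fin n → Fin n → ℝ := fun u v => if u < v ∧ G.Adj u v then 1 else 0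
  have hedge : (G.edgeSet.ncard : ℝ) = ∑ u, ∑ v, A u v := by
    have h := ncard_edges_eq_sum G fun _ _ => True
    simp only [or_self, if_true, mul_one, and_true] at h
    rw [← h]
    congr 2
    ext e
    induction e using Sym2.ind with
    | _ u v => exact ⟨fun h => ⟨h, u, v, rfl⟩, fun h => h.1⟩
  let B : Fin r × Fin r → Set (Fin n → Option (Fin r)) := fun ij =>
    {σ | ¬ |∑ u, ∑ v, A u v * (if σ u = some ij.1 ∧ σ v = some ij.2 then 1 else 0) -
      p ij.1 * p ij.2 * ∑ u, ∑ v, A u v| ≤ ζ / 2 * (p ij.1 * p ij.2 * n)}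
  set E := Real.exp (-(ζ ^ 3 * pm * n / l)) with hE
  have hB : ∀ ij, weightOf (partWeight p) (B ij) ≤ 2 * E := by
    rintro ⟨i, j⟩
    by_cases hEhalf : 1 / 2 ≤ E
    · calc weightOf (partWeight p) (B (i, j)) ≤ weightOf (partWeight p) Set.univ :=
            weightOf_mono hw (Set.subset_univ _)
        _ = 1 := by simp [weightOf, htotal]
        _ ≤ 2 * E := by linarith
    have hpm0 : 0 < pm := by
      by_contra hcon
      refine hEhalf ?_
      have : 1 ≤ E := Real.one_le_exp (by
        rw [neg_nonneg]
        exact div_nonpos_of_nonpos_of_nonneg (mul_nonpos_of_nonpos_of_nonneg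
          (mul_nonpos_of_nonneg_of_nonpos (by positivity) (not_lt.1 hcon)) hn0.le) hl0.le)
      linarith
    have hexp3 : Real.exp (-(3 * (ζ ^ 3 * pm * n / l))) = E ^ 3 := by
      rw [hE, ← Real.exp_nat_mul]; congr 1; push_cast; ring
    have hpi : ∀ i, p i ≤ 1 := fun i =>
      (Finset.single_le_sum (fun k _ => (hp0 k).le) (Finset.mem_univ i)).trans hpsum
    have hnl : (n : ℝ) / l ≤ Real.log n ^ 3 := by
      rw [div_le_iff₀ (by positivity)] at hl ⊢
      linarith
    have hdegTail : (n : ℝ) * Real.exp (-(l * p i)) ≤ E ^ 3 := by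
      rw [← hexp3]
      nth_rewrite 1 [← Real.exp_log hn0]
      rw [← Real.exp_add]
      refine Real.exp_le_exp.2 ?_
      have h1 : (n : ℝ) / Real.log n ^ 5 ≤ l * p i := by
        calc (n : ℝ) / Real.log n ^ 5 = n / Real.log n ^ 3 * (Real.log n ^ 2)⁻¹ := by
              field_simp
          _ ≤ l * p i := mul_le_mul hl (hp i) (by positivity) hl0.le
      have h2 : 3 * (ζ ^ 3 * pm * n / l) ≤ Real.log n ^ 3 := by
        calc 3 * (ζ ^ 3 * pm * n / l) = (3 * ζ ^ 3 * pm) * (n / l) := by ring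
          _ ≤ 1 * (n / l) := by
              gcongr
              have h3 : ζ ^ 3 ≤ ζ := by
                simpa using pow_le_pow_of_le_one hζ.le (by linarith) (show 1 ≤ 3 by norm_num)
              have h4 : pm ≤ 1 := (hpm i).trans (hpi i)
              exact mul_le_one₀ (by linarith) hpm0.le h4
          _ ≤ _ := by rw [one_mul]; exact hnl
      linarith
    have htail : ∀ k (m : ℝ), 0 < m → m ≤ 384 →
        Real.exp (-(ζ ^ 2 * p k * n / (m * C * l))) ≤ E ^ 3 := by
      intro k m hm0 hm
      rw [← hexp3]
      refine Real.exp_le_exp.2 (neg_le_neg ?_)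
      calc 3 * (ζ ^ 3 * pm * n / l) = ζ ^ 2 * n / l * (3 * ζ * pm) := by ring
        _ ≤ ζ ^ 2 * n / l * (1 / (m * C) * p k) := by
            gcongr
            · rw [le_div_iff₀ (by positivity)]
              have : ζ * (m * C) ≤ ζ * (384 * C) := by gcongr
              nlinarith
            · exact hpm k
        _ = _ := by field_simp
    have hdev := weightOf_edge_deviation_le hμ hμ1 (some i) (some j) (hp0 i) (hp0 j)
      (by omega) A (fun u v => by simp only [A]; split_ifs <;> norm_num)
      (fun u v => by simp only [A]; split_ifs <;> norm_num)
      (fun u v h => by simp [A, h]) hl0 hC hζ (by linarith)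
      (fun v => by
        refine le_trans ?_ ((sum_ite_adj_le_ncard G v fun u => u < v).trans (hdeg v))
        simp only [A, G.adj_comm v, le_refl])
      (fun u => by
        refine le_trans ?_ ((sum_ite_adj_le_ncard G u fun v => u < v).trans (hdeg u))
        exact le_of_eq (Finset.sum_congr rfl fun v _ => by simp only [A]; congr))
      (hedge ▸ he)
    have hsix : weightOf (partWeight p) (B (i, j)) ≤ 6 * E ^ 3 := by
      refine hdev.trans ?_
      have h1 := htail i 64 (by norm_num) (by norm_num)
      have h2 := htail j 384 (by norm_num) le_rfl
      simp only [μ, Option.elim]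
      linarith
    refine hsix.trans ?_
    have hE0 : 0 < E := Real.exp_pos _
    have hE2 : E ^ 2 ≤ 1 / 4 := by nlinarith
    nlinarith
  change _ ≤ weightOf (partWeight p) _
  rw [weightOf_compl, htotal]
  refine sub_le_sub_left ((weightOf_mono hw (T := ⋃ ij, B ij) ?_).trans
    ((weightOf_iUnion_le hw B).trans ((Finset.sum_le_sum fun ij _ => hB ij).trans_eq ?_))) 1
  swap
  · simp; ring
  intro σ hσ
  by_contra hcon
  simp only [B, Set.mem_iUnion, not_exists, Set.mem_ofPred_eq, not_not, Prod.forall] at hcon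
  refine hσ ⟨fun i j hij => ?_, fun i => ?_⟩
  · have hcount := ncard_edges_eq_sum G fun u v => u ∈ part σ i ∧ v ∈ part σ j
    have hsplit : ((edgesBetween G (part σ i) (part σ j)).ncard : ℝ) =
        ∑ u, ∑ v, A u v * (if σ u = some i ∧ σ v = some j then 1 else 0) +
          ∑ u, ∑ v, A u v * (if σ u = some j ∧ σ v = some i then 1 else 0) := by
      refine hcount.trans ?_
      simp only [← Finset.sum_add_distrib, ← mul_add]
      refine Finset.sum_congr rfl fun u _ => Finset.sum_congr rfl fun v _ => congrArg _ ?_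
      simp only [part, Set.mem_ofPred_eq]
      by_cases h1 : σ u = some i
      · have h2 : σ u ≠ some j := by rw [h1]; simpa using hij
        simp [h1, hij]
      · by_cases h2 : σ u = some j <;> by_cases h3 : σ v = some i <;>
          simp [h1, h2, h3, hij.symm]
    rw [hsplit, hedge]
    have h1 := hcon i j
    have h2 := hcon j i
    rw [abs_le] at h1 h2 ⊢
    constructor <;> linarith
  · have hcount := ncard_edges_eq_sum G fun u v => u ∈ part σ i ∧ v ∈ part σ i
    have hsum : ((edgesBetween G (part σ i) (part σ i)).ncard : ℝ) =
        ∑ u, ∑ v, A u v * (if σ u = some i ∧ σ v = some i then 1 else 0) := by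
      refine hcount.trans ?_
      refine Finset.sum_congr rfl fun u _ => Finset.sum_congr rfl fun v _ => congrArg _ ?_
      simp only [part, Set.mem_ofPred_eq, and_comm (a := σ v = some i), or_self]
    rw [hsum, hedge]
    have h1 := hcon i i
    have h2 : 0 < p i * p i * n := mul_pos (mul_pos (hp0 i) (hp0 i)) hn0
    rw [abs_le] at h1 ⊢
    constructor <;> nlinarith
end

section
/- For all f, C ∈ ℕ there exists ε₀ > 0 such that for every 0 < ε ≤ ε₀ there exists n₀ ∈ ℕ with the following property for all n ≥ n₀ and all r ∈ ℕ. Suppose ℓ ≥ n^{2/3}, G is an n-vertex graph, and φ is an m-colouring of G that is Cn-bounded and locally ℓ-bounded. Fix a k-vertex subset U of V(G). Let each colour of [m] be independently assigned to the class I_j with probability p_j for j ∈ [r], where p_j ≥ (log n)^{−2} for each j and Σ_{j∈[r]} p_j ≤ 1. Suppose 𝓕 is a collection of f-vertex, h-edge rainbow subgraphs of G such that U is an independent set of each R ∈ 𝓕 and, for some a ≥ 1, each R ∈ 𝓕 has at most a edges incident to U. Then for each j ∈ [r], with probability at least 1 − 2·exp(−ε⁴·p_j^{2a−1}·n/ℓ),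 the number of graphs R ∈ 𝓕 all of whose edge colours belong to I_j is p_j^h·|𝓕| ± ε·p_j^h·n^{f−k}. -/
open Paper

/-- The probability of the assignment `σ` of colours to classes, when each colour is
independently assigned to class `j` with probability `p j` (and to no class with the
remaining probability). -/
noncomputable def colWeight {m r : ℕ} (p : Fin r → ℝ)
    (σ : Fin m → Option (Fin r)) : ℝ :=
  ∏ c, ((σ c).elim (1 - ∑ j, p j) p)

section Concentration

open Finset Function

variable {κ Ω ι : Type*} [Fintype κ] [DecidableEq κ] [Fintype Ω]

/-- The product weight on `κ → Ω` with marginal `q` in every coordinate. -/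
noncomputable def prodWeight (q : Ω → ℝ) (σ : κ → Ω) : ℝ := ∏ c, q (σ c)

/-- The sum over `R ∈ 𝓡` of the monomials with variables indexed by `S R`. -/
noncomputable def monomialSum (𝓡 : Finset ι) (S : ι → Finset κ) (y : κ → ℝ) : ℝ :=
  ∑ R ∈ 𝓡, ∏ c ∈ S R, y c

/-- The partial derivative of `monomialSum` in the variable `c`. -/
noncomputable def monomialSumDeriv (𝓡 : Finset ι) (S : ι → Finset κ) (c : κ) (y : κ → ℝ) : ℝ :=
  ∑ R ∈ 𝓡 with c ∈ S R, ∏ c' ∈ S R \ {c}, y c'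

/-- The values `x (σ c)`, with those of the coordinates in `M` replaced by `p`. -/
noncomputable def averaged (x : Ω → ℝ) (p : ℝ) (M : Finset κ) (σ : κ → Ω) (c : κ) : ℝ :=
  if c ∈ M then p else x (σ c)

omit [Fintype κ] in
lemma monomialSum_update_sub (𝓡 : Finset ι) (S : ι → Finset κ) (y : κ → ℝ) (c : κ) (u v : ℝ) :
    monomialSum 𝓡 S (update y c u) - monomialSum 𝓡 S (update y c v) =
      (u - v) * monomialSumDeriv 𝓡 S c y := by
  unfold monomialSum monomialSumDeriv
  rw [← sum_sub_distrib, sum_filter, mul_sum]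
  refine sum_congr rfl fun R _ => ?_
  split_ifs with hc
  · rw [prod_update_of_mem hc, prod_update_of_mem hc]; ring
  · rw [prod_update_of_notMem hc, prod_update_of_notMem hc]; ring

omit [DecidableEq κ] [Fintype Ω] in
lemma prodWeight_nonneg {q : Ω → ℝ} (hq : ∀ ω, 0 ≤ q ω) (σ : κ → Ω) : 0 ≤ prodWeight q σ :=
  prod_nonneg fun _ _ => hq _

lemma sum_prodWeight {q : Ω → ℝ} (hq1 : ∑ ω, q ω = 1) : ∑ σ : κ → Ω, prodWeight q σ = 1 := by
  unfold prodWeight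
  rw [← Fintype.piFinset_univ, ← Finset.prod_univ_sum (fun _ : κ => univ) (fun _ ω => q ω)]
  simp [hq1]

lemma sum_prodWeight_mul_resample {q : Ω → ℝ} (hq1 : ∑ ω, q ω = 1) (g : (κ → Ω) → ℝ) (c : κ) :
    ∑ σ, prodWeight q σ * g σ = ∑ σ, prodWeight q σ * ∑ ω, q ω * g (update σ c ω) := by
  have h1 : ∑ σ, prodWeight q σ * ∑ ω, q ω * g (update σ c ω) =
      ∑ z : (κ → Ω) × Ω, prodWeight q z.1 * (q z.2 * g (update z.1 c z.2)) := by
    rw [Fintype.sum_prod_type]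
    simp_rw [mul_sum]
  have h2 : ∑ σ, prodWeight q σ * g σ = ∑ z : (κ → Ω) × Ω, prodWeight q z.1 * (q z.2 * g z.1) := by
    rw [Fintype.sum_prod_type]
    refine sum_congr rfl fun σ _ => ?_
    simp only
    rw [← mul_sum, ← sum_mul, hq1, one_mul]
  have hswap : ∀ (σ : κ → Ω) (ω : Ω),
      prodWeight q σ * q ω = prodWeight q (update σ c ω) * q (σ c) := by
    intro σ ω
    unfold prodWeight
    rw [← mul_prod_erase univ _ (mem_univ c),
      ← mul_prod_erase univ (fun i => q (update σ c ω i)) (mem_univ c)]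
    have : ∏ i ∈ univ.erase c, q (update σ c ω i) = ∏ i ∈ univ.erase c, q (σ i) :=
      prod_congr rfl fun i hi => by rw [update_of_ne (ne_of_mem_erase hi)]
    rw [this, update_self]
    ring
  rw [h1, h2]
  refine sum_nbij' (fun z => (update z.1 c z.2, z.1 c)) (fun z => (update z.1 c z.2, z.1 c))
    (by simp) (by simp) (by simp) (by simp) ?_
  rintro ⟨σ, ω⟩ -
  simp only [update_idem, update_eq_self]
  rw [← mul_assoc, ← mul_assoc, hswap]

/-- The exponential moment of a centred, rescaled Bernoulli variable. -/
lemma sum_exp_centred_le {q : Ω → ℝ} (hq1 : ∑ ω, q ω = 1)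
    {x : Ω → ℝ} (hx : ∀ ω, x ω = 0 ∨ x ω = 1) {p : ℝ} (hp0 : 0 ≤ p) (hp : ∑ ω, q ω * x ω = p)
    {y : ℝ} (hy : |y| ≤ 1) :
    ∑ ω, q ω * Real.exp (y * (x ω - p)) ≤ Real.exp (p * y ^ 2) := by
  have h1 : ∀ ω, q ω * Real.exp (y * (x ω - p)) =
      Real.exp (-(y * p)) * (q ω + q ω * x ω * (Real.exp y - 1)) := by
    intro ω
    rw [mul_sub, sub_eq_neg_add, Real.exp_add]
    rcases hx ω with h | h <;> simp [h] <;> ring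
  rw [sum_congr rfl fun ω _ => h1 ω, ← mul_sum, sum_add_distrib, ← sum_mul, hq1, hp]
  have h2 : Real.exp y - 1 ≤ y + y ^ 2 := by
    have := (abs_le.1 (Real.abs_exp_sub_one_sub_id_le hy)).2
    linarith
  have h3 : 1 + p * (Real.exp y - 1) ≤ Real.exp (p * (y + y ^ 2)) := by
    have := Real.add_one_le_exp (p * (y + y ^ 2))
    have := mul_le_mul_of_nonneg_left h2 hp0
    linarith
  calc _ ≤ Real.exp (-(y * p)) * Real.exp (p * (y + y ^ 2)) := by gcongr
    _ = _ := by rw [← Real.exp_add]; ring_nf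

/-- Averaging out the coordinates in `M` of a sum of monomials has a sub-Gaussian error. -/
lemma sum_exp_averaged_sub_le {q : Ω → ℝ} (hq : ∀ ω, 0 ≤ q ω) (hq1 : ∑ ω, q ω = 1)
    {x : Ω → ℝ} (hx : ∀ ω, x ω = 0 ∨ x ω = 1) {p : ℝ} (hp0 : 0 ≤ p) (hp1 : p ≤ 1)
    (hp : ∑ ω, q ω * x ω = p)
    (𝓡 : Finset ι) (S : ι → Finset κ) (D : κ → ℝ) (t : ℝ) (M M₀ : Finset κ)
    (hMM : Disjoint M₀ M) (ht : ∀ c ∈ M, |t| * D c ≤ 1)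
    (hD : ∀ c ∈ M, ∀ y : κ → ℝ, (∀ c', 0 ≤ y c' ∧ y c' ≤ 1) → (∀ c' ∈ M₀, y c' = p) →
      monomialSumDeriv 𝓡 S c y ≤ D c) :
    ∑ σ, prodWeight q σ * Real.exp (t * (monomialSum 𝓡 S (averaged x p M₀ σ) -
        monomialSum 𝓡 S (averaged x p (M₀ ∪ M) σ))) ≤
      Real.exp (t ^ 2 * (p * ∑ c ∈ M, D c ^ 2)) := by
  induction M using Finset.induction_on generalizing M₀ with
  | empty => simp [sum_prodWeight hq1]
  | insert c M hcM ih =>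
    have hcM₀ : c ∉ M₀ := fun h => (Finset.disjoint_left.1 hMM h) (mem_insert_self _ _)
    have hupd : ∀ (σ : κ → Ω) (ω : Ω),
        averaged x p M₀ (update σ c ω) = update (averaged x p M₀ σ) c (x ω) := by
      intro σ ω
      ext c'
      by_cases h : c' = c
      · subst h; simp [averaged, hcM₀]
      · simp [averaged, h]
    have hins : ∀ σ : κ → Ω,
        averaged x p (insert c M₀) σ = update (averaged x p M₀ σ) c p := by
      intro σ
      ext c'
      by_cases h : c' = c
      · subst h; simp [averaged]
      · simp [averaged, h]
    have hconst : ∀ (σ : κ → Ω) (ω : Ω) (M' : Finset κ), c ∈ M' →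
        averaged x p M' (update σ c ω) = averaged x p M' σ := by
      intro σ ω M' hM'
      ext c'
      by_cases h : c' = c
      · subst h; simp [averaged, hM']
      · simp [averaged, h]
    have hun : M₀ ∪ insert c M = insert c M₀ ∪ M := by
      rw [union_insert, insert_union]
    rw [hun, sum_prodWeight_mul_resample hq1 _ c]
    have hdisj : Disjoint (insert c M₀) M := by
      rw [disjoint_insert_left]
      exact ⟨hcM, (disjoint_insert_right.1 hMM).2⟩
    have ih' := ih (insert c M₀) hdisj (fun c' hc' => ht c' (mem_insert_of_mem hc'))
      (fun c' hc' y hy hyp => hD c' (mem_insert_of_mem hc') y hy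
        fun c'' hc'' => hyp c'' (mem_insert_of_mem hc''))
    have hstep : ∀ σ : κ → Ω, ∑ ω, q ω * Real.exp (t *
        (monomialSum 𝓡 S (averaged x p M₀ (update σ c ω)) -
          monomialSum 𝓡 S (averaged x p (insert c M₀ ∪ M) (update σ c ω)))) ≤
        Real.exp (t ^ 2 * (p * D c ^ 2)) * Real.exp (t *
          (monomialSum 𝓡 S (averaged x p (insert c M₀) σ) -
            monomialSum 𝓡 S (averaged x p (insert c M₀ ∪ M) σ))) := by
      intro σ
      have hy01 : ∀ c', 0 ≤ averaged x p M₀ σ c' ∧ averaged x p M₀ σ c' ≤ 1 := by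
        intro c'
        unfold averaged
        split_ifs
        · exact ⟨hp0, hp1⟩
        · rcases hx (σ c') with h | h <;> simp [h]
      have hdle : monomialSumDeriv 𝓡 S c (averaged x p M₀ σ) ≤ D c :=
        hD c (mem_insert_self _ _) _ hy01 fun c' hc' => by simp [averaged, hc']
      have hd0 : 0 ≤ monomialSumDeriv 𝓡 S c (averaged x p M₀ σ) :=
        sum_nonneg fun _ _ => prod_nonneg fun c' _ => (hy01 c').1
      set d := monomialSumDeriv 𝓡 S c (averaged x p M₀ σ)
      have hdt : |t * d| ≤ 1 := by
        rw [abs_mul, abs_of_nonneg hd0]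
        exact (mul_le_mul_of_nonneg_left hdle (abs_nonneg t)).trans (ht c (mem_insert_self _ _))
      have hfac : ∀ ω, Real.exp (t *
          (monomialSum 𝓡 S (averaged x p M₀ (update σ c ω)) -
            monomialSum 𝓡 S (averaged x p (insert c M₀ ∪ M) (update σ c ω)))) =
          Real.exp (t * d * (x ω - p)) * Real.exp (t *
            (monomialSum 𝓡 S (averaged x p (insert c M₀) σ) -
              monomialSum 𝓡 S (averaged x p (insert c M₀ ∪ M) σ))) := by
        intro ω
        rw [← Real.exp_add, hconst σ ω _ (mem_union_left _ (mem_insert_self _ _)), hupd, hins]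
        have := monomialSum_update_sub 𝓡 S (averaged x p M₀ σ) c (x ω) p
        congr 1
        linear_combination t * this
      simp_rw [hfac, ← mul_assoc]
      rw [← sum_mul]
      refine mul_le_mul_of_nonneg_right ?_ (Real.exp_nonneg _)
      refine (sum_exp_centred_le hq1 hx hp0 hp hdt).trans ?_
      rw [Real.exp_le_exp]
      have : d ^ 2 ≤ D c ^ 2 := by gcongr
      rw [mul_pow, mul_left_comm, mul_assoc (t ^ 2)]
      exact mul_le_mul_of_nonneg_left (mul_le_mul_of_nonneg_left this hp0) (sq_nonneg t)
    calc _ ≤ ∑ σ, prodWeight q σ * (Real.exp (t ^ 2 * (p * D c ^ 2)) * Real.exp (t *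
          (monomialSum 𝓡 S (averaged x p (insert c M₀) σ) -
            monomialSum 𝓡 S (averaged x p (insert c M₀ ∪ M) σ)))) :=
          sum_le_sum fun σ _ => mul_le_mul_of_nonneg_left (hstep σ) (prodWeight_nonneg hq σ)
      _ = Real.exp (t ^ 2 * (p * D c ^ 2)) * ∑ σ, prodWeight q σ * Real.exp (t *
          (monomialSum 𝓡 S (averaged x p (insert c M₀) σ) -
            monomialSum 𝓡 S (averaged x p (insert c M₀ ∪ M) σ))) := by
          rw [mul_sum]
          exact sum_congr rfl fun σ _ => by ring
      _ ≤ Real.exp (t ^ 2 * (p * D c ^ 2)) * Real.exp (t ^ 2 * (p * ∑ c ∈ M, D c ^ 2)) := by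
          gcongr
      _ = _ := by
          rw [← Real.exp_add, sum_insert hcM]
          ring_nf

open Classical in
/-- The tail bound for averaging out the coordinates in `M`. -/
lemma sum_averaged_tail_le {q : Ω → ℝ} (hq : ∀ ω, 0 ≤ q ω) (hq1 : ∑ ω, q ω = 1)
    {x : Ω → ℝ} (hx : ∀ ω, x ω = 0 ∨ x ω = 1) {p : ℝ} (hp0 : 0 ≤ p) (hp1 : p ≤ 1)
    (hp : ∑ ω, q ω * x ω = p)
    (𝓡 : Finset ι) (S : ι → Finset κ) (D : κ → ℝ) {t : ℝ} (ht0 : 0 ≤ t) (M M₀ : Finset κ)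
    (hMM : Disjoint M₀ M) (ht : ∀ c ∈ M, t * D c ≤ 1)
    (hD : ∀ c ∈ M, ∀ y : κ → ℝ, (∀ c', 0 ≤ y c' ∧ y c' ≤ 1) → (∀ c' ∈ M₀, y c' = p) →
      monomialSumDeriv 𝓡 S c y ≤ D c) {s E : ℝ}
    (hE : E ≤ t * s - t ^ 2 * (p * ∑ c ∈ M, D c ^ 2)) :
    ∑ σ, prodWeight q σ * (if s < |monomialSum 𝓡 S (averaged x p M₀ σ) -
        monomialSum 𝓡 S (averaged x p (M₀ ∪ M) σ)| then 1 else 0) ≤ 2 * Real.exp (-E) := by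
  have h1 := sum_exp_averaged_sub_le hq hq1 hx hp0 hp1 hp 𝓡 S D t M M₀ hMM
    (by rwa [abs_of_nonneg ht0]) hD
  have h2 := sum_exp_averaged_sub_le hq hq1 hx hp0 hp1 hp 𝓡 S D (-t) M M₀ hMM
    (by rwa [abs_neg, abs_of_nonneg ht0]) hD
  rw [neg_sq] at h2
  set Z : (κ → Ω) → ℝ := fun σ => monomialSum 𝓡 S (averaged x p M₀ σ) -
        monomialSum 𝓡 S (averaged x p (M₀ ∪ M) σ)
  have hpt : ∀ σ, (if s < |Z σ| then (1 : ℝ) else 0) ≤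
      Real.exp (-(t * s)) * (Real.exp (t * Z σ) + Real.exp (-t * Z σ)) := by
    intro σ
    split_ifs with h
    · have : t * s ≤ |t * Z σ| := by
        rw [abs_mul, abs_of_nonneg ht0]; gcongr
      rw [mul_add, ← Real.exp_add, ← Real.exp_add]
      rcases le_abs.1 this with h' | h'
      · have := Real.one_le_exp (show 0 ≤ -(t * s) + t * Z σ by linarith)
        have := Real.exp_nonneg (-(t * s) + -t * Z σ)
        linarith
      · have := Real.one_le_exp (show 0 ≤ -(t * s) + -t * Z σ by linarith)
        have := Real.exp_nonneg (-(t * s) + t * Z σ)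
        linarith
    · positivity
  calc _ ≤ ∑ σ, prodWeight q σ *
        (Real.exp (-(t * s)) * (Real.exp (t * Z σ) + Real.exp (-t * Z σ))) :=
        sum_le_sum fun σ _ => mul_le_mul_of_nonneg_left (hpt σ) (prodWeight_nonneg hq σ)
    _ = Real.exp (-(t * s)) * (∑ σ, prodWeight q σ * Real.exp (t * Z σ) +
          ∑ σ, prodWeight q σ * Real.exp (-t * Z σ)) := by
        rw [← sum_add_distrib, mul_sum]
        exact sum_congr rfl fun σ _ => by ring
    _ ≤ Real.exp (-(t * s)) * (Real.exp (t ^ 2 * (p * ∑ c ∈ M, D c ^ 2)) +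
          Real.exp (t ^ 2 * (p * ∑ c ∈ M, D c ^ 2))) := by gcongr
    _ = 2 * Real.exp (-(t * s) + t ^ 2 * (p * ∑ c ∈ M, D c ^ 2)) := by
        rw [Real.exp_add]; ring
    _ ≤ _ := by gcongr; linarith

open Classical in
/-- Concentration of a sum of monomials of degree `h` in Bernoulli variables, when every variable
outside the exceptional set `H` occurs in few monomials and every monomial has at most `a`
variables in `H`. -/
lemma sum_monomialSum_tail_le {q : Ω → ℝ} (hq : ∀ ω, 0 ≤ q ω) (hq1 : ∑ ω, q ω = 1)
    {x : Ω → ℝ} (hx : ∀ ω, x ω = 0 ∨ x ω = 1) {p : ℝ} (hp0 : 0 < p) (hp1 : p ≤ 1)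
    (hp : ∑ ω, q ω * x ω = p)
    (𝓡 : Finset ι) (S : ι → Finset κ) (H : Finset κ) {h a : ℕ} (ha : 1 ≤ a)
    (hSh : ∀ R ∈ 𝓡, #(S R) = h) (hSa : ∀ R ∈ 𝓡, #(S R ∩ H) ≤ a)
    {N K B Q s ε : ℝ} (hN : 0 < N) (hK : 1 ≤ K) (hB : 1 ≤ B) (hQ : 0 < Q) (hs : 0 < s)
    (hε : 0 < ε) (hε1 : ε ≤ 1 / (128 * K * B ^ 2))
    (hd : ∀ c, (#{R ∈ 𝓡 | c ∈ S R} : ℝ) ≤ K * N / Q)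
    (hdl : ∀ c ∉ H, (#{R ∈ 𝓡 | c ∈ S R} : ℝ) ≤ N / s)
    (hdsum : ∑ c, (#{R ∈ 𝓡 | c ∈ S R} : ℝ) ≤ B ^ 2 * N)
    (hsQ : 2 * (ε ^ 4 * p ^ (2 * a - 1) * Q) ≤ s * p ^ (2 * h) * ε ^ 2 / (64 * B ^ 2)) :
    ∑ σ, prodWeight q σ * (if ε * p ^ h * N / 2 <
        |monomialSum 𝓡 S (fun c => x (σ c)) - p ^ h * #𝓡| then 1 else 0) ≤
      4 * Real.exp (-(2 * (ε ^ 4 * p ^ (2 * a - 1) * Q))) := by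
  set d : κ → ℝ := fun c => (#{R ∈ 𝓡 | c ∈ S R} : ℝ) with hddef
  have hd0 : ∀ c, 0 ≤ d c := fun c => Nat.cast_nonneg _
  have hph : 0 < p ^ h := by positivity
  have hph1 : p ^ h ≤ 1 := pow_le_one₀ hp0.le hp1
  have hKB : 1 ≤ K * B ^ 2 := one_le_mul_of_one_le_of_one_le hK (one_le_pow₀ hB)
  have hεKB : ε * (128 * (K * B ^ 2)) ≤ 1 := by
    rw [le_div_iff₀ (by positivity)] at hε1
    linarith
  have hεle : ε ≤ 1 := by nlinarith
  have hlight := sum_averaged_tail_le (κ := κ) hq hq1 hx hp0.le hp1 hp 𝓡 S d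
    (t := ε * p ^ h / (8 * B ^ 2) * s / N) (by positivity) (univ \ H) ∅ (by simp)
    (s := ε * p ^ h * N / 4) (E := 2 * (ε ^ 4 * p ^ (2 * a - 1) * Q))
    (by
      intro c hc
      have h1 := hdl c (by simpa using hc)
      calc ε * p ^ h / (8 * B ^ 2) * s / N * d c
          ≤ ε * p ^ h / (8 * B ^ 2) * s / N * (N / s) := by gcongr
        _ = ε * p ^ h / (8 * B ^ 2) := by field_simp
        _ ≤ 1 := by
          rw [div_le_one (by positivity)]
          have : ε * p ^ h ≤ 1 := mul_le_one₀ hεle hph.le hph1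
          nlinarith)
    (by
      intro c _ y hy _
      unfold monomialSumDeriv
      simp only [hddef, card_eq_sum_ones, Nat.cast_sum, Nat.cast_one]
      exact sum_le_sum fun R _ => prod_le_one (fun c' _ => (hy c').1) fun c' _ => (hy c').2)
    (by
      have h1 : ∑ c ∈ univ \ H, d c ^ 2 ≤ N / s * (B ^ 2 * N) := by
        calc ∑ c ∈ univ \ H, d c ^ 2 ≤ ∑ c ∈ univ \ H, N / s * d c := by
              refine sum_le_sum fun c hc => ?_
              rw [sq]
              exact mul_le_mul_of_nonneg_right (hdl c (by simpa using hc)) (hd0 c)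
          _ = N / s * ∑ c ∈ univ \ H, d c := by rw [mul_sum]
          _ ≤ N / s * ∑ c, d c := by
              have := sum_le_sum_of_subset_of_nonneg (subset_univ (univ \ H)) fun c _ _ => hd0 c
              exact mul_le_mul_of_nonneg_left this (by positivity)
          _ ≤ _ := by gcongr
      have h2 : p * ∑ c ∈ univ \ H, d c ^ 2 ≤ N / s * (B ^ 2 * N) := by
        have : 0 ≤ ∑ c ∈ univ \ H, d c ^ 2 := sum_nonneg fun _ _ => sq_nonneg _
        nlinarith
      have h3 := mul_le_mul_of_nonneg_left h2 (sq_nonneg (ε * p ^ h / (8 * B ^ 2) * s / N))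
      refine hsQ.trans ?_
      refine le_trans (le_of_eq ?_) (sub_le_sub_left h3 _)
      field_simp
      ring)
  have hheavy := sum_averaged_tail_le (κ := κ) hq hq1 hx hp0.le hp1 hp 𝓡 S
    (fun c => p ^ h / p ^ a * d c)
    (t := ε / (8 * K * B ^ 2) * (p ^ (2 * a - 1) / p ^ h) * Q / N) (by positivity) H (univ \ H)
    sdiff_disjoint
    (s := ε * p ^ h * N / 4) (E := 2 * (ε ^ 4 * p ^ (2 * a - 1) * Q))
    (by
      intro c _
      have h1 : p ^ (2 * a - 1) ≤ p ^ a := pow_le_pow_of_le_one hp0.le hp1 (by omega)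
      calc ε / (8 * K * B ^ 2) * (p ^ (2 * a - 1) / p ^ h) * Q / N * (p ^ h / p ^ a * d c)
          ≤ ε / (8 * K * B ^ 2) * (p ^ a / p ^ h) * Q / N * (p ^ h / p ^ a * (K * N / Q)) := by
            gcongr
            exact hd c
        _ = ε / (8 * B ^ 2) := by field_simp
        _ ≤ 1 := by
          rw [div_le_one (by positivity)]
          nlinarith [one_le_pow₀ hB (n := 2)])
    (by
      intro c hc y hy hyp
      unfold monomialSumDeriv
      simp only [hddef, card_eq_sum_ones, Nat.cast_sum, Nat.cast_one, mul_sum, mul_one]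
      refine sum_le_sum fun R hR => ?_
      have hR' := (mem_filter.1 hR).1
      have h1 : S R \ H ⊆ S R \ {c} := sdiff_subset_sdiff Subset.rfl (by simpa using hc)
      have h2 : ∏ c' ∈ S R \ {c}, y c' ≤ ∏ c' ∈ S R \ H, y c' :=
        Finset.prod_le_prod_of_subset_of_le_one h1 (fun c' _ => (hy c').1) fun c' _ _ => (hy c').2
      have h3 : ∏ c' ∈ S R \ H, y c' = p ^ #(S R \ H) := by
        rw [← prod_const]
        exact prod_congr rfl fun c' hc' => hyp c' (by simpa using (mem_sdiff.1 hc').2)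
      have h4 : h ≤ #(S R \ H) + a := by
        have := card_sdiff_add_card_inter (S R) H
        have := hSh R hR'
        have := hSa R hR'
        omega
      rw [le_div_iff₀ (by positivity)]
      calc _ ≤ p ^ #(S R \ H) * p ^ a := by rw [← h3]; gcongr
        _ = p ^ (#(S R \ H) + a) := by rw [pow_add]
        _ ≤ p ^ h := pow_le_pow_of_le_one hp0.le hp1 h4)
    (by
      have h1 : ∑ c ∈ H, (p ^ h / p ^ a * d c) ^ 2 ≤
          (p ^ h / p ^ a) ^ 2 * (K * N / Q * (B ^ 2 * N)) := by
        calc ∑ c ∈ H, (p ^ h / p ^ a * d c) ^ 2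
            ≤ ∑ c ∈ H, (p ^ h / p ^ a) ^ 2 * (K * N / Q * d c) := by
              refine sum_le_sum fun c hc => ?_
              rw [mul_pow, sq (d c)]
              exact mul_le_mul_of_nonneg_left
                (mul_le_mul_of_nonneg_right (hd c) (hd0 c)) (by positivity)
          _ = (p ^ h / p ^ a) ^ 2 * (K * N / Q * ∑ c ∈ H, d c) := by
              rw [mul_sum, mul_sum]
          _ ≤ (p ^ h / p ^ a) ^ 2 * (K * N / Q * ∑ c, d c) := by
              have := sum_le_sum_of_subset_of_nonneg (subset_univ H) fun c _ _ => hd0 c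
              exact mul_le_mul_of_nonneg_left
                (mul_le_mul_of_nonneg_left this (by positivity)) (by positivity)
          _ ≤ _ := by gcongr
      have h2 := mul_le_mul_of_nonneg_left h1 hp0.le
      have h3 := mul_le_mul_of_nonneg_left h2
        (sq_nonneg (ε / (8 * K * B ^ 2) * (p ^ (2 * a - 1) / p ^ h) * Q / N))
      refine le_trans ?_ (sub_le_sub_left h3 _)
      have hpa : p ^ (2 * a - 1) * p = p ^ a * p ^ a := by
        rw [← pow_succ, ← pow_add]; congr 1; omega
      have h4 : (ε / (8 * K * B ^ 2) * (p ^ (2 * a - 1) / p ^ h) * Q / N) ^ 2 *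
          (p * ((p ^ h / p ^ a) ^ 2 * (K * N / Q * (B ^ 2 * N)))) =
          ε ^ 2 / (64 * K * B ^ 2) * p ^ (2 * a - 1) * Q := by
        have : (ε / (8 * K * B ^ 2) * (p ^ (2 * a - 1) / p ^ h) * Q / N) ^ 2 *
          (p * ((p ^ h / p ^ a) ^ 2 * (K * N / Q * (B ^ 2 * N)))) =
          ε ^ 2 / (64 * K * B ^ 2) * p ^ (2 * a - 1) * Q *
            (p ^ (2 * a - 1) * p / (p ^ a * p ^ a)) := by
          field_simp
          ring
        rw [this, hpa, div_self (by positivity), mul_one]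
      have h5 : ε / (8 * K * B ^ 2) * (p ^ (2 * a - 1) / p ^ h) * Q / N * (ε * p ^ h * N / 4) =
          2 * (ε ^ 2 / (64 * K * B ^ 2) * p ^ (2 * a - 1) * Q) := by
        field_simp
        ring
      rw [h4, h5]
      have h6 : 2 * ε ^ 4 ≤ ε ^ 2 / (64 * K * B ^ 2) := by
        rw [le_div_iff₀ (by positivity)]
        have : ε ^ 2 * (128 * (K * B ^ 2)) ≤ 1 := by nlinarith
        nlinarith [sq_nonneg ε]
      have h7 : 0 ≤ p ^ (2 * a - 1) * Q := by positivity
      nlinarith)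
  have hun : univ \ H ∪ H = univ := by simp
  rw [hun] at hheavy
  rw [empty_union] at hlight
  have he0 : ∀ σ : κ → Ω, averaged x p ∅ σ = fun c => x (σ c) := fun σ => by
    ext c; simp [averaged]
  have he1 : ∀ σ : κ → Ω, monomialSum 𝓡 S (averaged x p univ σ) = p ^ h * #𝓡 := fun σ => by
    simp only [monomialSum, averaged, mem_univ, if_true, prod_const]
    rw [sum_congr rfl fun R hR => by rw [hSh R hR], sum_const, nsmul_eq_mul, mul_comm]
  simp only [he0] at hlight
  simp only [he1] at hheavy
  calc _ ≤ ∑ σ, (prodWeight q σ * (if ε * p ^ h * N / 4 < |monomialSum 𝓡 S (fun c => x (σ c)) -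
          monomialSum 𝓡 S (averaged x p (univ \ H) σ)| then 1 else 0) +
        prodWeight q σ * (if ε * p ^ h * N / 4 < |monomialSum 𝓡 S (averaged x p (univ \ H) σ) -
          p ^ h * #𝓡| then 1 else 0)) := by
        refine sum_le_sum fun σ _ => ?_
        rw [← mul_add]
        refine mul_le_mul_of_nonneg_left ?_ (prodWeight_nonneg hq σ)
        have := abs_sub_le (monomialSum 𝓡 S (fun c => x (σ c)))
          (monomialSum 𝓡 S (averaged x p (univ \ H) σ)) (p ^ h * #𝓡)
        split_ifs <;> linarith
    _ ≤ _ := by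
        rw [sum_add_distrib]
        linarith

open Classical in
/-- A set containing the complement of an unlikely event has large weight. -/
lemma one_sub_le_sum_indicator {q : Ω → ℝ} (hq : ∀ ω, 0 ≤ q ω) (hq1 : ∑ ω, q ω = 1)
    {bad : (κ → Ω) → Prop} {good : Set (κ → Ω)} {Z : ℝ}
    (hbad : ∑ σ, prodWeight q σ * (if bad σ then 1 else 0) ≤ 4 * Real.exp (-(2 * Z)))
    (hgood : ∀ σ, ¬ bad σ → σ ∈ good) :
    1 - 2 * Real.exp (-Z) ≤ ∑ σ, good.indicator (prodWeight q) σ := by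
  have h1 : ∀ σ, prodWeight q σ - prodWeight q σ * (if bad σ then 1 else 0) ≤
      good.indicator (prodWeight q) σ := by
    intro σ
    split_ifs with h
    · rw [mul_one, sub_self]
      exact Set.indicator_nonneg (fun σ _ => prodWeight_nonneg hq σ) σ
    · rw [Set.indicator_of_mem (hgood σ h), mul_zero, sub_zero]
  have h2 : 0 ≤ ∑ σ, good.indicator (prodWeight q) σ :=
    sum_nonneg fun σ _ => Set.indicator_nonneg (fun σ _ => prodWeight_nonneg hq σ) σ
  have h3 := sum_le_sum fun σ (_ : σ ∈ univ) => h1 σ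
  rw [sum_sub_distrib, sum_prodWeight hq1] at h3
  have hexp : Real.exp (-(2 * Z)) = Real.exp (-Z) ^ 2 := by
    rw [← Real.exp_nat_mul]; congr 1; push_cast; ring
  rw [hexp] at hbad
  have he := Real.exp_pos (-Z)
  rcases le_or_gt (Real.exp (-Z)) (1 / 2) with hc | hc
  · nlinarith
  · linarith

omit [Fintype κ] [DecidableEq κ] in
/-- Discarding a few monomials from a sum barely affects its deviation from its mean. -/
lemma abs_monomialSum_sub_le {𝓕 𝓡 : Finset ι} [DecidableEq ι] (hsub : 𝓡 ⊆ 𝓕)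
    (S : ι → Finset κ) {y : κ → ℝ} (hy : ∀ c, 0 ≤ y c ∧ y c ≤ 1) {t b : ℝ} (ht0 : 0 ≤ t)
    (ht1 : t ≤ 1) (hrem : (#(𝓕 \ 𝓡) : ℝ) ≤ b / 2)
    (h : |monomialSum 𝓡 S y - t * #𝓡| ≤ b / 2) : |monomialSum 𝓕 S y - t * #𝓕| ≤ b := by
  have hsplit : monomialSum 𝓕 S y = monomialSum (𝓕 \ 𝓡) S y + monomialSum 𝓡 S y :=
    (sum_sdiff hsub).symm
  have hcard : (#𝓕 : ℝ) = #(𝓕 \ 𝓡) + #𝓡 := by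
    exact_mod_cast (card_sdiff_add_card_eq_card hsub).symm
  have hlo : 0 ≤ monomialSum (𝓕 \ 𝓡) S y :=
    sum_nonneg fun R _ => prod_nonneg fun c _ => (hy c).1
  have hhi : monomialSum (𝓕 \ 𝓡) S y ≤ #(𝓕 \ 𝓡) := by
    rw [card_eq_sum_ones, Nat.cast_sum, Nat.cast_one]
    exact sum_le_sum fun R _ => prod_le_one (fun c _ => (hy c).1) fun c _ => (hy c).2
  have h1 : t * #(𝓕 \ 𝓡) ≤ #(𝓕 \ 𝓡) := mul_le_of_le_one_left (Nat.cast_nonneg _) ht1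
  have h0 : 0 ≤ t * #(𝓕 \ 𝓡) := mul_nonneg ht0 (Nat.cast_nonneg _)
  rw [hsplit, hcard, mul_add]
  have hle := abs_le.1 h
  rw [abs_le]
  constructor <;> linarith [hle.1, hle.2]

end Concentration

section Counting

open Finset Paper

variable {V : Type*} {G : SimpleGraph V}

open Classical in
lemma card_subgraphs_le [Fintype V] {f : ℕ} (W : Finset V) (𝓡 : Finset G.Subgraph)
    (hf : ∀ R ∈ 𝓡, R.verts.ncard = f) (hW : ∀ R ∈ 𝓡, ↑W ⊆ R.verts) :
    #𝓡 * Fintype.card V ^ #W ≤ 2 ^ (f + 1).choose 2 * Fintype.card V ^ f := by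
  rcases 𝓡.eq_empty_or_nonempty with rfl | ⟨R₀, hR₀⟩
  · simp
  have hcard : ∀ R ∈ 𝓡, #R.verts.toFinset = f := fun R hR => by
    rw [← hf R hR, Set.ncard_eq_toFinset_card']
  have hsub : ∀ R ∈ 𝓡, W ⊆ R.verts.toFinset := fun R hR => by
    simpa [← Finset.coe_subset] using hW R hR
  have hWf : #W ≤ f := hcard R₀ hR₀ ▸ card_le_card (hsub R₀ hR₀)
  have h1 : #𝓡 ≤ 2 ^ (f + 1).choose 2 * #(powersetCard (f - #W) (univ : Finset V)) := by
    refine card_le_mul_card_image_of_maps_to (f := fun R => R.verts.toFinset \ W) ?_ _ ?_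
    · intro R hR
      rw [mem_powersetCard]
      exact ⟨subset_univ _, by rw [card_sdiff_of_subset (hsub R hR), hcard R hR]⟩
    · intro b hb
      have hb' : #(b ∪ W) ≤ f := by
        have := card_union_le b W
        have := (mem_powersetCard.1 hb).2
        omega
      have hverts : ∀ R ∈ 𝓡, R.verts.toFinset \ W = b → R.verts.toFinset = b ∪ W :=
        fun R hR hRb => by rw [← hRb, sdiff_union_of_subset (hsub R hR)]
      calc #{R ∈ 𝓡 | R.verts.toFinset \ W = b} ≤ #(b ∪ W).sym2.powerset := by
            refine card_le_card_of_injOn (fun R => R.edgeSet.toFinset) ?_ ?_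
            · intro R hR
              obtain ⟨hR, hRb⟩ := mem_filter.1 hR
              simp only [mem_coe, mem_powerset]
              rw [← hverts R hR hRb]
              intro e he
              rw [Set.mem_toFinset] at he
              rw [mem_sym2_iff]
              intro x hx
              rw [Set.mem_toFinset]
              exact R.mem_verts_of_mem_edge he hx
            · intro R hR R' hR' hRR'
              obtain ⟨hR, hRb⟩ := mem_filter.1 hR
              obtain ⟨hR', hRb'⟩ := mem_filter.1 hR'
              have hv : R.verts = R'.verts := by
                rw [← Set.toFinset_inj, hverts R hR hRb, hverts R' hR' hRb']
              have he : R.edgeSet = R'.edgeSet := Set.toFinset_inj.1 hRR'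
              refine SimpleGraph.Subgraph.ext hv ?_
              ext u v
              rw [← SimpleGraph.Subgraph.mem_edgeSet, he, SimpleGraph.Subgraph.mem_edgeSet]
        _ = 2 ^ (#(b ∪ W) + 1).choose 2 := by rw [card_powerset, card_sym2]
        _ ≤ _ := by
            gcongr
            norm_num
  rw [card_powersetCard, card_univ] at h1
  calc #𝓡 * Fintype.card V ^ #W
      ≤ 2 ^ (f + 1).choose 2 * Fintype.card V ^ (f - #W) * Fintype.card V ^ #W := by
        gcongr
        exact h1.trans (by gcongr; exact Nat.choose_le_pow _ _)
    _ = _ := by rw [mul_assoc, ← pow_add, Nat.sub_add_cancel hWf]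

/-- Real form of `card_subgraphs_le`, relative to a set contained in all the subgraphs. -/
lemma card_subgraphs_le_div [Fintype V] [Nonempty V] {f k w : ℕ} (hkf : k ≤ f) (W : Finset V)
    (hWk : #W = k + w) (𝓡 : Finset G.Subgraph)
    (hf : ∀ R ∈ 𝓡, R.verts.ncard = f) (hW : ∀ R ∈ 𝓡, ↑W ⊆ R.verts) :
    (#𝓡 : ℝ) ≤ 2 ^ (f + 1).choose 2 * (Fintype.card V : ℝ) ^ (f - k) / Fintype.card V ^ w := by
  have h1 : (#𝓡 : ℝ) * Fintype.card V ^ #W ≤ 2 ^ (f + 1).choose 2 * Fintype.card V ^ f := by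
    exact_mod_cast card_subgraphs_le W 𝓡 hf hW
  have hn : (0 : ℝ) < Fintype.card V := by exact_mod_cast Fintype.card_pos
  rw [le_div_iff₀ (by positivity)]
  rw [hWk] at h1
  obtain ⟨j, rfl⟩ := Nat.exists_eq_add_of_le hkf
  rw [Nat.add_sub_cancel_left]
  rw [pow_add, pow_add] at h1
  refine le_of_mul_le_mul_right ?_ (show (0 : ℝ) < Fintype.card V ^ k by positivity)
  linarith

variable {C : Type*}

open Classical in
/-- Few subgraphs in a family have an edge of colour `c` disjoint from a common vertex set. -/
lemma card_colour_outside_le [Fintype V] [Nonempty V] [DecidableEq C] {φ : Sym2 V → C} {b : ℝ}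
    (hφ : GBounded G φ b) {f : ℕ} (U : Finset V) (hkf : #U ≤ f) (𝓡 : Finset G.Subgraph)
    (hf : ∀ R ∈ 𝓡, R.verts.ncard = f) (hU : ∀ R ∈ 𝓡, ↑U ⊆ R.verts) (c : C) :
    (#{R ∈ 𝓡 | ∃ e ∈ R.edgeSet, φ e = c ∧ ∀ x ∈ U, x ∉ e} : ℝ) ≤
      b * (2 ^ (f + 1).choose 2 * (Fintype.card V : ℝ) ^ (f - #U) / Fintype.card V ^ 2) := by
  set T : Finset (Sym2 V) := (colourCls G φ c).toFinset
  have hT : ∀ e, e ∈ T ↔ e ∈ G.edgeSet ∧ φ e = c := fun e => Set.mem_toFinset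
  set T' : Finset (Sym2 V) := {e ∈ T | ∀ x ∈ U, x ∉ e}
  have hsub : ({R ∈ 𝓡 | ∃ e ∈ R.edgeSet, φ e = c ∧ ∀ x ∈ U, x ∉ e} : Finset G.Subgraph) ⊆
      T'.biUnion fun e => {R ∈ 𝓡 | e ∈ R.edgeSet} := by
    intro R hR
    obtain ⟨hR, e, he, hec, heU⟩ := mem_filter.1 hR
    simp only [mem_biUnion, mem_filter, T', hT]
    exact ⟨e, ⟨⟨R.edgeSet_subset he, hec⟩, heU⟩, hR, he⟩
  have hone : ∀ e ∈ T', (#{R ∈ 𝓡 | e ∈ R.edgeSet} : ℝ) ≤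
      2 ^ (f + 1).choose 2 * (Fintype.card V : ℝ) ^ (f - #U) / Fintype.card V ^ 2 := by
    intro e he
    obtain ⟨he, heU⟩ := mem_filter.1 he
    have heG : e ∈ G.edgeSet := ((hT e).1 he).1
    refine card_subgraphs_le_div hkf (U ∪ e.toFinset) ?_ _
      (fun R hR => hf R (mem_filter.1 hR).1) ?_
    · rw [card_union_of_disjoint, Sym2.card_toFinset_of_not_isDiag _
        (G.not_isDiag_of_mem_edgeSet heG)]
      rw [Finset.disjoint_left]
      exact fun x hx hxe => heU x hx (Sym2.mem_toFinset.1 hxe)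
    · intro R hR x hx
      obtain ⟨hR, heR⟩ := mem_filter.1 hR
      rcases mem_union.1 (mem_coe.1 hx) with hx | hx
      · exact hU R hR hx
      · exact R.mem_verts_of_mem_edge heR (Sym2.mem_toFinset.1 hx)
  have hTb : (#T' : ℝ) ≤ b := by
    refine le_trans ?_ (hφ c)
    rw [Set.ncard_eq_toFinset_card']
    exact_mod_cast card_le_card (filter_subset _ _)
  calc _ ≤ ((∑ e ∈ T', #{R ∈ 𝓡 | e ∈ R.edgeSet} : ℕ) : ℝ) := by
        exact_mod_cast (card_le_card hsub).trans card_biUnion_le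
    _ ≤ #T' * (2 ^ (f + 1).choose 2 * (Fintype.card V : ℝ) ^ (f - #U) / Fintype.card V ^ 2) := by
        push_cast
        rw [← nsmul_eq_mul]
        exact sum_le_card_nsmul _ _ _ hone
    _ ≤ _ := by gcongr

open Classical in
/-- Few subgraphs in a family have an edge of colour `c` meeting a common independent set. -/
lemma card_colour_meeting_le [Fintype V] [Nonempty V] [DecidableEq C] {φ : Sym2 V → C} {l : ℝ}
    (hφ : LBounded G φ l) {f : ℕ} (U : Finset V) (hkf : #U ≤ f) (𝓡 : Finset G.Subgraph)
    (hf : ∀ R ∈ 𝓡, R.verts.ncard = f) (hU : ∀ R ∈ 𝓡, ↑U ⊆ R.verts)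
    (hind : ∀ R ∈ 𝓡, ∀ u ∈ U, ∀ v ∈ U, s(u, v) ∉ R.edgeSet) (c : C) :
    (#{R ∈ 𝓡 | ∃ e ∈ R.edgeSet, φ e = c ∧ ∃ x ∈ U, x ∈ e} : ℝ) ≤
      #U * (l * (2 ^ (f + 1).choose 2 * (Fintype.card V : ℝ) ^ (f - #U) / Fintype.card V)) := by
  set T : V → Finset V := fun u => ({v | G.Adj u v ∧ φ s(u, v) = c} : Set V).toFinset
  have hT : ∀ u v, v ∈ T u ↔ G.Adj u v ∧ φ s(u, v) = c := fun u v => Set.mem_toFinset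
  set T' : V → Finset V := fun u => T u \ U with hT'
  have hsub : ({R ∈ 𝓡 | ∃ e ∈ R.edgeSet, φ e = c ∧ ∃ x ∈ U, x ∈ e} : Finset G.Subgraph) ⊆
      U.biUnion fun u => (T' u).biUnion fun v => {R ∈ 𝓡 | s(u, v) ∈ R.edgeSet} := by
    intro R hR
    obtain ⟨hR, e, he, hec, u, hu, hue⟩ := mem_filter.1 hR
    obtain ⟨v, rfl⟩ := Sym2.mem_iff_exists.1 hue
    simp only [mem_biUnion, mem_filter, hT', hT, mem_sdiff]
    exact ⟨u, hu, v, ⟨⟨R.edgeSet_subset he, hec⟩, fun hv => hind R hR u hu v hv he⟩, hR, he⟩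
  have hone : ∀ u ∈ U, ∀ v ∈ T' u, (#{R ∈ 𝓡 | s(u, v) ∈ R.edgeSet} : ℝ) ≤
      2 ^ (f + 1).choose 2 * (Fintype.card V : ℝ) ^ (f - #U) / Fintype.card V := by
    intro u hu v hv
    have hv' : v ∉ U := (mem_sdiff.1 hv).2
    have := card_subgraphs_le_div (w := 1) hkf (insert v U) (card_insert_of_notMem hv')
      ({R ∈ 𝓡 | s(u, v) ∈ R.edgeSet} : Finset G.Subgraph) (fun R hR => hf R (mem_filter.1 hR).1) (by
        intro R hR x hx
        obtain ⟨hR, heR⟩ := mem_filter.1 hR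
        rcases mem_insert.1 (mem_coe.1 hx) with rfl | hx
        · exact R.mem_verts_of_mem_edge heR (Sym2.mem_mk_right _ _)
        · exact hU R hR hx)
    rwa [pow_one] at this
  have hTb : ∀ u, (#(T' u) : ℝ) ≤ l := by
    intro u
    refine le_trans ?_ (hφ u c)
    rw [Set.ncard_eq_toFinset_card']
    exact_mod_cast card_le_card sdiff_subset
  set X : ℝ := 2 ^ (f + 1).choose 2 * (Fintype.card V : ℝ) ^ (f - #U) / Fintype.card V
  calc _ ≤ ((∑ u ∈ U, ∑ v ∈ T' u, #{R ∈ 𝓡 | s(u, v) ∈ R.edgeSet} : ℕ) : ℝ) := by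
        exact_mod_cast (card_le_card hsub).trans
          (card_biUnion_le.trans (sum_le_sum fun u _ => card_biUnion_le))
    _ ≤ ∑ u ∈ U, l * X := by
        push_cast
        refine sum_le_sum fun u hu => ?_
        calc _ ≤ #(T' u) * X := by
              rw [← nsmul_eq_mul]
              exact sum_le_card_nsmul _ _ _ (hone u hu)
          _ ≤ _ := by
              have := hTb u
              gcongr
    _ = _ := by rw [sum_const, nsmul_eq_mul]

/-- The colours of the edges of a subgraph. -/
noncomputable def edgeColours [Finite V] (φ : Sym2 V → C) (R : G.Subgraph) : Finset C :=
  (R.edgeSet.toFinite.image φ).toFinset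

lemma mem_edgeColours [Finite V] {φ : Sym2 V → C} {R : G.Subgraph} {c : C} :
    c ∈ edgeColours φ R ↔ ∃ e ∈ R.edgeSet, φ e = c := by
  simp [edgeColours]

lemma card_edgeColours [Finite V] {φ : Sym2 V → C} {R : G.Subgraph}
    (hR : Rainbow φ R.edgeSet) : #(edgeColours φ R) = R.edgeSet.ncard := by
  rw [edgeColours, ← Set.ncard_eq_toFinset_card _ (R.edgeSet.toFinite.image φ),
    Set.InjOn.ncard_image hR]

lemma ncard_edgeSet_le [Finite V] (R : G.Subgraph) :
    R.edgeSet.ncard ≤ (R.verts.ncard + 1).choose 2 := by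
  have := Fintype.ofFinite V
  classical
  rw [Set.ncard_eq_toFinset_card', Set.ncard_eq_toFinset_card', ← card_sym2]
  refine card_le_card fun e he => ?_
  rw [Set.mem_toFinset] at he
  rw [mem_sym2_iff]
  intro x hx
  rw [Set.mem_toFinset]
  exact R.mem_verts_of_mem_edge he hx

lemma sum_card_filter_edgeColours [Finite V] [Fintype C] [DecidableEq C] {φ : Sym2 V → C} {h : ℕ}
    (𝓕 : Finset G.Subgraph) (hcol : ∀ R ∈ 𝓕, #(edgeColours φ R) = h) :
    ∑ c, #{R ∈ 𝓕 | c ∈ edgeColours φ R} = #𝓕 * h := by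
  simp_rw [card_filter]
  rw [sum_comm, ← smul_eq_mul, ← sum_const]
  refine sum_congr rfl fun R hR => ?_
  rw [← card_filter, ← hcol R hR]
  simp

open Classical in
/-- Every colour appears on a small proportion of a family of subgraphs sharing an independent
set. -/
lemma card_filter_edgeColours_le [Fintype V] [Nonempty V] [DecidableEq C] {φ : Sym2 V → C}
    {b l : ℝ} (hb0 : 0 ≤ b) (hl : 1 ≤ l) (hφb : GBounded G φ (b * Fintype.card V))
    (hφl : LBounded G φ l) {f : ℕ} (U : Finset V) (hkf : #U ≤ f) (𝓕 : Finset G.Subgraph)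
    (hf : ∀ R ∈ 𝓕, R.verts.ncard = f) (hU : ∀ R ∈ 𝓕, ↑U ⊆ R.verts)
    (hind : ∀ R ∈ 𝓕, ∀ u ∈ U, ∀ v ∈ U, s(u, v) ∉ R.edgeSet) (c : C) :
    (#{R ∈ 𝓕 | c ∈ edgeColours φ R} : ℝ) ≤ 2 ^ (f + 1).choose 2 * (f + b) *
      (Fintype.card V : ℝ) ^ (f - #U) / (Fintype.card V / l) := by
  have hn : (0 : ℝ) < Fintype.card V := by exact_mod_cast Fintype.card_pos
  have hsub : ({R ∈ 𝓕 | c ∈ edgeColours φ R} : Finset G.Subgraph) ⊆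
      {R ∈ 𝓕 | ∃ e ∈ R.edgeSet, φ e = c ∧ ∀ x ∈ U, x ∉ e} ∪
        {R ∈ 𝓕 | ∃ e ∈ R.edgeSet, φ e = c ∧ ∃ x ∈ U, x ∈ e} := by
    intro R hR
    obtain ⟨hR, hc⟩ := mem_filter.1 hR
    obtain ⟨e, he, hec⟩ := mem_edgeColours.1 hc
    by_cases hx : ∃ x ∈ U, x ∈ e
    · exact mem_union_right _ (mem_filter.2 ⟨hR, e, he, hec, hx⟩)
    · push Not at hx
      exact mem_union_left _ (mem_filter.2 ⟨hR, e, he, hec, hx⟩)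
  have hcard := (card_le_card hsub).trans (card_union_le _ _)
  rw [← Nat.cast_le (α := ℝ), Nat.cast_add] at hcard
  refine hcard.trans ((add_le_add (card_colour_outside_le hφb U hkf 𝓕 hf hU c)
    (card_colour_meeting_le hφl U hkf 𝓕 hf hU hind c)).trans ?_)
  have h3 : (#U : ℝ) ≤ f := by exact_mod_cast hkf
  set n : ℝ := (Fintype.card V : ℝ)
  set X : ℝ := 2 ^ (f + 1).choose 2 * n ^ (f - #U)
  have hX : 0 < X := by positivity
  calc b * n * (X / n ^ 2) + #U * (l * (X / n))
      = (b * 1 + #U * l) * (X / n) := by field_simp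
    _ ≤ (b * l + f * l) * (X / n) := by gcongr
    _ = X * (f + b) / (n / l) := by field_simp; ring
    _ = _ := by ring

open Classical in
/-- After discarding few members of a family of rainbow subgraphs, the frequently used colours
occur only on edges meeting the common independent set `U`. -/
lemma exists_subfamily_frequent_colours [Fintype V] [Nonempty V] [Fintype C] [DecidableEq C] {φ : Sym2 V → C}
    {b l : ℝ} (hb0 : 0 ≤ b) (hl : 1 ≤ l) (hφb : GBounded G φ (b * Fintype.card V))
    (hφl : LBounded G φ l) {f h a : ℕ} (U : Finset V) (hkf : #U ≤ f)
    (hh : h ≤ (f + 1).choose 2) (𝓕 : Finset G.Subgraph)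
    (hf : ∀ R ∈ 𝓕, R.verts.ncard = f) (hU : ∀ R ∈ 𝓕, ↑U ⊆ R.verts)
    (hind : ∀ R ∈ 𝓕, ∀ u ∈ U, ∀ v ∈ U, s(u, v) ∉ R.edgeSet)
    (hcol : ∀ R ∈ 𝓕, #(edgeColours φ R) = h)
    (ha : ∀ R ∈ 𝓕, {e ∈ R.edgeSet | ∃ x ∈ U, x ∈ e}.ncard ≤ a)
    {B N : ℝ} (hB : B = 2 ^ (f + 1).choose 2) (hN : N = (Fintype.card V : ℝ) ^ (f - #U)) :
    ∃ (H : Finset C) (𝓡 : Finset G.Subgraph), 𝓡 ⊆ 𝓕 ∧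
      (∀ R ∈ 𝓡, #(edgeColours φ R ∩ H) ≤ a) ∧
      (∀ c, (#{R ∈ 𝓡 | c ∈ edgeColours φ R} : ℝ) ≤ B * (f + b) * N / (Fintype.card V / l)) ∧
      (∀ c ∉ H, (#{R ∈ 𝓡 | c ∈ edgeColours φ R} : ℝ) ≤ N / √(Fintype.card V)) ∧
      (∑ c, (#{R ∈ 𝓡 | c ∈ edgeColours φ R} : ℝ) ≤ B ^ 2 * N) ∧
      (#(𝓕 \ 𝓡) : ℝ) ≤ b * B ^ 3 * N / √(Fintype.card V) := by
  set n : ℝ := (Fintype.card V : ℝ) with hndef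
  have hn : 0 < n := by rw [hndef]; exact_mod_cast Fintype.card_pos
  have hN0 : 0 < N := by rw [hN]; positivity
  have hB0 : 0 < B := by rw [hB]; positivity
  have hhB : (h : ℝ) ≤ B := by
    rw [hB]
    exact_mod_cast hh.trans Nat.lt_two_pow_self.le
  have hout := card_colour_outside_le hφb U hkf 𝓕 hf hU
  rw [← hndef, ← hB, ← hN] at hout
  set d : C → ℝ := fun c => (#{R ∈ 𝓕 | c ∈ edgeColours φ R} : ℝ)
  have hsum : ∑ c, d c ≤ B ^ 2 * N := by
    have h1 := sum_card_filter_edgeColours 𝓕 hcol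
    have h2 : (#𝓕 : ℝ) ≤ B * N := by
      have := card_subgraphs_le_div (w := 0) hkf U rfl 𝓕 hf hU
      rwa [← hndef, ← hB, ← hN, pow_zero, div_one] at this
    calc ∑ c, d c = #𝓕 * h := by simp only [d]; exact_mod_cast h1
      _ ≤ B * N * B := by gcongr
      _ = _ := by ring
  set H : Finset C := {c | N / √n < d c} with hH
  set 𝓡 : Finset G.Subgraph := {R ∈ 𝓕 | ∀ e ∈ R.edgeSet, φ e ∈ H → ∃ x ∈ U, x ∈ e} with h𝓡
  have hsub : 𝓡 ⊆ 𝓕 := filter_subset _ _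
  have hdle : ∀ c, (#{R ∈ 𝓡 | c ∈ edgeColours φ R} : ℝ) ≤ d c := fun c => by
    simp only [d]
    exact_mod_cast card_le_card (filter_subset_filter _ hsub)
  refine ⟨H, 𝓡, hsub, ?_, ?_, ?_, ?_, ?_⟩
  · intro R hR
    obtain ⟨hR, hRH⟩ := mem_filter.1 hR
    refine le_trans ?_ (ha R hR)
    have hfin : {e ∈ R.edgeSet | ∃ x ∈ U, x ∈ e}.Finite := Set.toFinite _
    rw [← Set.ncard_coe_finset]
    refine le_trans (Set.ncard_le_ncard ?_ (hfin.image φ)) (Set.ncard_image_le hfin)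
    intro c hc
    obtain ⟨hc, hcH⟩ := mem_inter.1 (mem_coe.1 hc)
    obtain ⟨e, he, rfl⟩ := mem_edgeColours.1 hc
    exact ⟨e, ⟨he, hRH e he hcH⟩, rfl⟩
  · intro c
    have h1 := card_filter_edgeColours_le hb0 hl hφb hφl U hkf 𝓕 hf hU hind c
    rw [← hndef, ← hB, ← hN] at h1
    exact (hdle c).trans h1
  · intro c hc
    refine (hdle c).trans ?_
    simpa [hH] using hc
  · exact (sum_le_sum fun c _ => hdle c).trans hsum
  · have hcardH : #H * (N / √n) ≤ B ^ 2 * N := by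
      calc #H * (N / √n) = ∑ c ∈ H, N / √n := by rw [sum_const, nsmul_eq_mul]
        _ ≤ ∑ c ∈ H, d c := sum_le_sum fun c hc => (mem_filter.1 hc).2.le
        _ ≤ ∑ c, d c :=
          sum_le_sum_of_subset_of_nonneg (subset_univ _) fun c _ _ => Nat.cast_nonneg _
        _ ≤ _ := hsum
    have hs : 0 < √n := Real.sqrt_pos.2 hn
    have hss : √n * √n = n := Real.mul_self_sqrt hn.le
    have h1 : 𝓕 \ 𝓡 ⊆ H.biUnion fun c =>
        {R ∈ 𝓕 | ∃ e ∈ R.edgeSet, φ e = c ∧ ∀ x ∈ U, x ∉ e} := by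
      intro R hR
      simp only [h𝓡, mem_sdiff, mem_filter, not_and] at hR
      obtain ⟨hR, h2⟩ := hR
      have h3 := h2 hR
      push Not at h3
      obtain ⟨e, he, heH, hx⟩ := h3
      exact mem_biUnion.2 ⟨φ e, heH, mem_filter.2 ⟨hR, e, he, rfl, hx⟩⟩
    calc (#(𝓕 \ 𝓡) : ℝ) ≤
          ((∑ c ∈ H, #{R ∈ 𝓕 | ∃ e ∈ R.edgeSet, φ e = c ∧ ∀ x ∈ U, x ∉ e} : ℕ) : ℝ) := by
          exact_mod_cast (card_le_card h1).trans card_biUnion_le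
      _ ≤ ∑ c ∈ H, b * n * (B * N / n ^ 2) := by
          push_cast
          exact sum_le_sum fun c _ => hout c
      _ = #H * (N / √n) * (b * B / √n) := by
          rw [sum_const, nsmul_eq_mul]
          field_simp
          rw [sq, hss]
      _ ≤ B ^ 2 * N * (b * B / √n) := by gcongr
      _ = _ := by ring

end Counting

section Numerics

open Filter

/-- Powers of the logarithm are negligible with respect to `n ^ (1/6)`. -/
lemma exists_forall_log_pow_le (j : ℕ) {δ : ℝ} (hδ : 0 < δ) :
    ∃ n₀ : ℕ, ∀ n : ℕ, n₀ ≤ n →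
      0 < n ∧ 1 ≤ Real.log n ∧ Real.log n ^ j ≤ δ * (n : ℝ) ^ ((1 : ℝ) / 6) := by
  have h1 : ∀ᶠ x : ℝ in atTop, ‖Real.log x ^ (j : ℝ)‖ ≤ δ * ‖x ^ ((1 : ℝ) / 6)‖ :=
    (isLittleO_log_rpow_rpow_atTop (j : ℝ) (by norm_num : (0 : ℝ) < 1 / 6)).def hδ
  have h2 : ∀ᶠ x : ℝ in atTop, 1 ≤ Real.log x := Real.tendsto_log_atTop.eventually_ge_atTop 1
  obtain ⟨n₀, hn₀⟩ := eventually_atTop.1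
    (tendsto_natCast_atTop_atTop.eventually (h1.and (h2.and (eventually_gt_atTop (0 : ℝ)))))
  refine ⟨n₀, fun n hn => ?_⟩
  obtain ⟨h3, h4, h5⟩ := hn₀ n hn
  refine ⟨by exact_mod_cast h5, h4, ?_⟩
  rw [Real.rpow_natCast, Real.norm_of_nonneg (by positivity),
    Real.norm_of_nonneg (by positivity)] at h3
  exact h3

end Numerics

open Finset in
/-- The number of members of a family all of whose colours are chosen, as a sum of monomials. -/
lemma ncard_eq_monomialSum {V C Ω : Type*} [Fintype V] [Fintype C] [DecidableEq C]
    [DecidableEq Ω] {G : SimpleGraph V} (φ : Sym2 V → C) (𝓕 : Finset G.Subgraph) (σ : C → Ω)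
    (i : Ω) :
    (({R ∈ (𝓕 : Set G.Subgraph) | ∀ e ∈ R.edgeSet, σ (φ e) = i}.ncard : ℕ) : ℝ) =
      monomialSum 𝓕 (edgeColours φ) fun c => if σ c = i then 1 else 0 := by
  classical
  have h1 : {R ∈ (𝓕 : Set G.Subgraph) | ∀ e ∈ R.edgeSet, σ (φ e) = i} =
      ({R ∈ 𝓕 | ∀ c ∈ edgeColours φ R, σ c = i} : Finset G.Subgraph) := by
    ext R
    simp [mem_edgeColours]
  rw [h1, Set.ncard_coe_finset, monomialSum, card_filter, Nat.cast_sum]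
  refine sum_congr rfl fun R _ => ?_
  rw [prod_boole]
  split_ifs <;> simp

open Finset in
/-- Lemma 2.16: concentration of the number of members of a family `𝓕` of rainbow
subgraphs whose colours all fall into a random colour class. -/
theorem stmt_15 :
    ∀ f Cb : ℕ,
    ∃ ε₀ : ℝ, 0 < ε₀ ∧ ∀ ε : ℝ, 0 < ε → ε ≤ ε₀ →
    ∃ n₀ : ℕ, ∀ n : ℕ, n₀ ≤ n → ∀ r : ℕ,
    ∀ l : ℝ, (n : ℝ) ^ ((2 : ℝ)/3) ≤ l →
    ∀ (G : SimpleGraph (Fin n)) (m : ℕ) (φ : Sym2 (Fin n) → Fin m),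
      GBounded G φ ((Cb : ℝ) * n) → LBounded G φ l →
    ∀ (U : Set (Fin n)) (k : ℕ), U.ncard = k →
    ∀ p : Fin r → ℝ,
      (∀ j, ((Real.log n) ^ 2)⁻¹ ≤ p j) → (∑ j, p j) ≤ 1 →
    ∀ (𝓕 : Set G.Subgraph) (h a : ℕ), 1 ≤ a →
      (∀ R ∈ 𝓕, R.verts.ncard = f ∧ R.edgeSet.ncard = h ∧
        Rainbow φ R.edgeSet ∧ U ⊆ R.verts ∧
        (∀ u ∈ U, ∀ v ∈ U, s(u, v) ∉ R.edgeSet) ∧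
        ({e ∈ R.edgeSet | ∃ x ∈ U, x ∈ e}).ncard ≤ a) →
    ∀ j : Fin r,
      1 - 2 * Real.exp (-(ε ^ 4 * p j ^ (2 * a - 1) * n / l)) ≤
        ∑ σ : Fin m → Option (Fin r),
          Set.indicator
            {σ' : Fin m → Option (Fin r) |
              |((({R ∈ 𝓕 | ∀ e ∈ R.edgeSet, σ' (φ e) = some j}).ncard : ℝ)) -
                  p j ^ h * (𝓕.ncard : ℝ)|
                ≤ ε * p j ^ h * (n : ℝ) ^ (f - k)}
            (colWeight p) σ := by
  classical
  intro f Cb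
  set B : ℝ := 2 ^ (f + 1).choose 2 with hB
  have hB1 : 1 ≤ B := one_le_pow₀ (by norm_num)
  set K : ℝ := B * (f + Cb) + 1 with hK
  have hK1 : 1 ≤ K := by
    have : 0 ≤ B * (f + Cb) := by positivity
    linarith
  have hKB1 : 1 ≤ K * B ^ 2 := one_le_mul_of_one_le_of_one_le hK1 (one_le_pow₀ hB1)
  refine ⟨1 / (128 * K * B ^ 2), by positivity, fun ε hε hε₀ => ?_⟩
  have hε1 : ε ≤ 1 := hε₀.trans (by rw [div_le_one (by positivity)]; linarith)
  obtain ⟨n₀, hn₀⟩ := exists_forall_log_pow_le (4 * (f + 1).choose 2)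
    (show 0 < ε / (128 * B ^ 3 * (Cb + 1)) by positivity)
  refine ⟨n₀, fun n hn r l hl G m φ hφb hφl U k hUk p hp hpsum 𝓕 h a ha h𝓕 j => ?_⟩
  obtain ⟨hn0, hlog, hlogn⟩ := hn₀ n hn
  have hnpos : (0 : ℝ) < n := by exact_mod_cast hn0
  have hn1 : (1 : ℝ) ≤ n := by exact_mod_cast hn0
  have : Nonempty (Fin n) := ⟨⟨0, hn0⟩⟩
  have hp0 : ∀ i, 0 < p i := fun i => lt_of_lt_of_le (by positivity) (hp i)
  have hpj1 : p j ≤ 1 :=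
    (single_le_sum (fun i _ => (hp0 i).le) (mem_univ j)).trans hpsum
  set q : Option (Fin r) → ℝ := fun o => o.elim (1 - ∑ i, p i) p with hq
  have hq0 : ∀ o, 0 ≤ q o := by
    rintro (_ | i)
    · simpa [hq] using hpsum
    · exact (hp0 i).le
  have hq1 : ∑ o, q o = 1 := by simp [hq, Fintype.sum_option]
  have hwt : ∀ σ : Fin m → Option (Fin r), colWeight p σ = prodWeight q σ := fun σ => rfl
  set Z : ℝ := ε ^ 4 * p j ^ (2 * a - 1) * n / l with hZ
  rcases 𝓕.eq_empty_or_nonempty with rfl | ⟨R₀, hR₀⟩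
  · have h1 : ∀ σ : Fin m → Option (Fin r), Set.indicator {σ' : Fin m → Option (Fin r) |
        |((({R ∈ (∅ : Set G.Subgraph) | ∀ e ∈ R.edgeSet, σ' (φ e) = some j}).ncard : ℝ)) -
          p j ^ h * ((∅ : Set G.Subgraph).ncard : ℝ)| ≤ ε * p j ^ h * (n : ℝ) ^ (f - k)}
        (colWeight p) σ = prodWeight q σ := by
      intro σ
      rw [Set.indicator_of_mem, hwt]
      have := (hp0 j).le
      have : 0 ≤ ε * p j ^ h * (n : ℝ) ^ (f - k) := by positivity
      simpa using this
    rw [sum_congr rfl fun σ _ => h1 σ, sum_prodWeight hq1]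
    linarith [Real.exp_pos (-Z)]
  have hl1 : 1 ≤ l := (Real.one_le_rpow hn1 (by norm_num)).trans hl
  have hUcard : #U.toFinset = k := by rw [← hUk, Set.ncard_eq_toFinset_card']
  have hkf : k ≤ f := by
    rw [← hUk, ← (h𝓕 R₀ hR₀).1]
    exact Set.ncard_le_ncard (h𝓕 R₀ hR₀).2.2.2.1
  have hh : h ≤ (f + 1).choose 2 := by
    have := ncard_edgeSet_le R₀
    rwa [(h𝓕 R₀ hR₀).1, (h𝓕 R₀ hR₀).2.1] at this
  set F : Finset G.Subgraph := 𝓕.toFinite.toFinset with hF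
  have hF𝓕 : (F : Set G.Subgraph) = 𝓕 := Set.Finite.coe_toFinset _
  have hmem : ∀ R ∈ F, R ∈ 𝓕 := fun R hR => by simpa [hF] using hR
  obtain ⟨H, 𝓡, hsub, hRa, hd, hdl, hdsum, hrem⟩ :=
    exists_subfamily_frequent_colours (b := Cb) (l := l) (φ := φ) (h := h) (a := a)
      (Nat.cast_nonneg _) hl1 (by simpa using hφb) hφl U.toFinset (hUcard ▸ hkf) hh F
      (fun R hR => (h𝓕 R (hmem R hR)).1)
      (fun R hR => by simpa using (h𝓕 R (hmem R hR)).2.2.2.1)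
      (fun R hR u hu v hv => (h𝓕 R (hmem R hR)).2.2.2.2.1 u (by simpa using hu) v
        (by simpa using hv))
      (fun R hR => (card_edgeColours (h𝓕 R (hmem R hR)).2.2.1).trans (h𝓕 R (hmem R hR)).2.1)
      (fun R hR => by simpa using (h𝓕 R (hmem R hR)).2.2.2.2.2) hB rfl
  rw [hUcard, Fintype.card_fin] at hd hdl hdsum hrem
  set N : ℝ := (n : ℝ) ^ (f - k) with hN
  have hN0 : 0 < N := by positivity
  have hQ : (n : ℝ) / l ≤ (n : ℝ) ^ ((1 : ℝ) / 3) := by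
    rw [div_le_iff₀ (by linarith)]
    calc (n : ℝ) = (n : ℝ) ^ ((1 : ℝ) / 3) * (n : ℝ) ^ ((2 : ℝ) / 3) := by
          rw [← Real.rpow_add hnpos]; norm_num
      _ ≤ _ := by gcongr
  have hsqrt : √(n : ℝ) = (n : ℝ) ^ ((1 : ℝ) / 3) * (n : ℝ) ^ ((1 : ℝ) / 6) := by
    rw [← Real.rpow_add hnpos, Real.sqrt_eq_rpow]; norm_num
  set L : ℝ := Real.log n
  have hpL : ∀ i, i ≤ 2 * (f + 1).choose 2 → 1 ≤ p j ^ i * L ^ (4 * (f + 1).choose 2) := by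
    intro i hi
    have h1 : 1 ≤ p j * L ^ 2 := by
      have := mul_le_mul_of_nonneg_right (hp j) (show 0 ≤ L ^ 2 by positivity)
      rwa [inv_mul_cancel₀ (by positivity)] at this
    calc 1 ≤ (p j * L ^ 2) ^ i := one_le_pow₀ h1
      _ = p j ^ i * L ^ (2 * i) := by rw [mul_pow, ← pow_mul]
      _ ≤ _ := by
        have := (hp0 j).le
        gcongr 1
        exact pow_le_pow_right₀ hlog (by omega)
  have h13 : 1 ≤ (n : ℝ) ^ ((1 : ℝ) / 3) := Real.one_le_rpow hn1 (by norm_num)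
  have hpn : ∀ i, i ≤ 2 * (f + 1).choose 2 →
      128 * B ^ 3 * (Cb + 1) ≤ ε * (p j ^ i * (n : ℝ) ^ ((1 : ℝ) / 6)) := by
    intro i hi
    have h1 := (hpL i hi).trans (mul_le_mul_of_nonneg_left hlogn (pow_nonneg (hp0 j).le i))
    have h2 : p j ^ i * (ε / (128 * B ^ 3 * (Cb + 1)) * (n : ℝ) ^ ((1 : ℝ) / 6)) =
      ε * (p j ^ i * (n : ℝ) ^ ((1 : ℝ) / 6)) / (128 * B ^ 3 * (Cb + 1)) := by ring
    rw [h2, le_div_iff₀ (by positivity), one_mul] at h1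
    exact h1
  have hB3 : 1 ≤ B ^ 3 := one_le_pow₀ hB1
  have hrem' : (#(F \ 𝓡) : ℝ) ≤ ε * p j ^ h * N / 2 := by
    refine hrem.trans ?_
    have h1 := hpn h (by omega)
    have h2 : ε * (p j ^ h * (n : ℝ) ^ ((1 : ℝ) / 6)) ≤ ε * p j ^ h * √n := by
      rw [hsqrt, mul_assoc]
      have := (hp0 j).le
      gcongr
      exact le_mul_of_one_le_left (by positivity) h13
    rw [div_le_iff₀ (by positivity)]
    have h3 : (Cb : ℝ) * B ^ 3 * 2 ≤ ε * p j ^ h * √n := by nlinarith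
    nlinarith
  have hsQ : 2 * (ε ^ 4 * p j ^ (2 * a - 1) * (n / l)) ≤
      √n * p j ^ (2 * h) * ε ^ 2 / (64 * B ^ 2) := by
    have h1 := hpn (2 * h) (by omega)
    have h2 : p j ^ (2 * a - 1) ≤ 1 := pow_le_one₀ (hp0 j).le hpj1
    have h3 : 128 * B ^ 2 ≤ p j ^ (2 * h) * (n : ℝ) ^ ((1 : ℝ) / 6) := by
      have h4 : 0 ≤ p j ^ (2 * h) * (n : ℝ) ^ ((1 : ℝ) / 6) :=
        mul_nonneg (pow_nonneg (hp0 j).le _) (by positivity)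
      have h5 : B ^ 2 ≤ B ^ 3 * (Cb + 1) :=
        (pow_le_pow_right₀ hB1 (by norm_num)).trans
          (le_mul_of_one_le_right (by positivity) (by linarith [Nat.cast_nonneg (α := ℝ) Cb]))
      nlinarith
    rw [le_div_iff₀ (by positivity), hsqrt]
    calc 2 * (ε ^ 4 * p j ^ (2 * a - 1) * (n / l)) * (64 * B ^ 2)
        ≤ 2 * (ε ^ 2 * 1 * (n : ℝ) ^ ((1 : ℝ) / 3)) * (64 * B ^ 2) := by
          have h6 : ε ^ 4 ≤ ε ^ 2 := pow_le_pow_of_le_one hε.le hε1 (by norm_num)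
          have := (hp0 j).le
          gcongr
      _ = ε ^ 2 * (n : ℝ) ^ ((1 : ℝ) / 3) * (128 * B ^ 2) := by ring
      _ ≤ ε ^ 2 * (n : ℝ) ^ ((1 : ℝ) / 3) * (p j ^ (2 * h) * (n : ℝ) ^ ((1 : ℝ) / 6)) := by
          gcongr
      _ = _ := by ring
  set x : Option (Fin r) → ℝ := fun o => if o = some j then 1 else 0 with hx
  have htail := sum_monomialSum_tail_le (κ := Fin m) (Ω := Option (Fin r)) hq0 hq1 (x := x)
    (fun o => by by_cases ho : o = some j <;> simp [hx, ho]) (hp0 j) hpj1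
    (by simp [hx, hq]) 𝓡 (edgeColours φ) H ha
    (fun R hR => (card_edgeColours (h𝓕 R (hmem R (hsub hR))).2.2.1).trans
      (h𝓕 R (hmem R (hsub hR))).2.1) hRa hN0 hK1 hB1 (Q := n / l) (by positivity)
    (Real.sqrt_pos.2 hnpos) hε hε₀
    (fun c => (hd c).trans (by
      have : 0 < l := by linarith
      gcongr
      linarith)) hdl hdsum hsQ
  have hZ' : ε ^ 4 * p j ^ (2 * a - 1) * (n / l) = Z := by rw [hZ, mul_div_assoc]
  rw [hZ'] at htail
  refine one_sub_le_sum_indicator hq0 hq1 htail fun σ hσ => ?_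
  rw [Set.mem_ofPred_eq, ← hF𝓕, ncard_eq_monomialSum, Set.ncard_coe_finset]
  exact abs_monomialSum_sub_le hsub _
    (fun c => by by_cases hc : σ c = some j <;> simp [hc]) (pow_nonneg (hp0 j).le _)
    (pow_le_one₀ (hp0 j).le hpj1) hrem' (not_lt.1 hσ)
end
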